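/- Let $m\geq3$, $1\leq t\leq m-2$, and let $f\in R_3(2t+1,m)$ with $|f|=8\cdot3^{m-t-2}$. Then there is an affine subspace $A$ of dimension $m-t+1$ of $\mathbb{F}_3^m$ containing the support $S$ of $f$, and $S$ is the union of two parallel hyperplanes of $A$ minus their intersection with two non-parallel hyperplanes of $A$. -/

import Mathlib

/-- Membership in the generalized Reed–Muller code `R_q(r,m)`: `f` is represented by a
polynomial of total degree at most `r` (equivalently, its reduced form has degree ≤ r). -/
def RM (F : Type) [Field F] (r m : ℕ) (f : (Fin m → F) → F) : Prop :=
  ∃ P : MvPolynomial (Fin m) F, P.totalDegree ≤ r ∧ ∀ x, MvPolynomial.eval x P = f x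

/-- Hamming weight: the size of the support of `f`. -/
def wt {F : Type} [Field F] [Fintype F] [DecidableEq F] {m : ℕ} (f : (Fin m → F) → F) : ℕ :=
  (Finset.univ.filter fun x => f x ≠ 0).card

set_option linter.unusedSectionVars false

namespace RMx
variable {F : Type} [Field F] [Fintype F] [hF : Fact (Fintype.card F = 3)]

lemma three_zero : (3 : F) = 0 := by
  have h := Nat.cast_card_eq_zero F
  rw [hF.out] at h
  exact_mod_cast h

lemma two_ne : (1 : F) ≠ -1 := by
  intro h
  have h3 : (3 : F) = 0 := three_zero
  have : (1 : F) = 0 := by linear_combination h3 - h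
  exact one_ne_zero this

lemma tri (a : F) : a = 0 ∨ a = 1 ∨ a = -1 := by
  have h := FiniteField.pow_card a
  rw [hF.out] at h
  have : a * ((a - 1) * (a + 1)) = 0 := by linear_combination h
  rcases mul_eq_zero.1 this with h | h
  · exact Or.inl h
  · rcases mul_eq_zero.1 h with h | h
    · exact Or.inr (Or.inl (by linear_combination h))
    · exact Or.inr (Or.inr (by linear_combination h))

/-- `D r f`: all r-fold differences of `f` vanish (degree less than r). -/
def D {F : Type} [Field F] {G : Type} [AddCommGroup G] : ℕ → (G → F) → Prop
  | 0, f => ∀ x, f x = 0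
  | r + 1, f => ∀ v, D r (fun x => f (x + v) - f x)

section D
variable {F : Type} [Field F] {G H : Type} [AddCommGroup G] [AddCommGroup H]

lemma D_comp (φ : H →+ G) (p : G) : ∀ (r : ℕ) (f : G → F), D r f → D r (fun h => f (p + φ h))
  | 0, f, hf => fun x => hf _
  | r + 1, f, hf => fun v => by
    have := D_comp φ p r _ (hf (φ v))
    simpa [add_assoc] using this

lemma D_zero : ∀ (r : ℕ), D r (fun _ : G => (0 : F))
  | 0 => fun _ => rfl
  | r + 1 => fun v => by simpa using D_zero r

lemma D_mono1 : ∀ (r : ℕ) (f : G → F), D r f → D (r + 1) f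
  | 0, f, hf => fun v x => by simp [hf _]
  | r + 1, f, hf => fun v => D_mono1 r _ (hf v)

lemma D_mono {r s : ℕ} (h : r ≤ s) {f : G → F} (hf : D r f) : D s f := by
  induction h with
  | refl => exact hf
  | step _ ih => exact D_mono1 _ _ ih

lemma D_add : ∀ (r : ℕ) (f g : G → F), D r f → D r g → D r (fun x => f x + g x)
  | 0, f, g, hf, hg => fun x => by simp [hf x, hg x]
  | r + 1, f, g, hf, hg => fun v => by
    have := D_add r _ _ (hf v) (hg v)
    convert this using 2
    ring

lemma D_const (r : ℕ) (c : F) : D (r + 1) (fun _ : G => c) := fun v => by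
  simpa using D_zero r

lemma D_shift (v : G) (r : ℕ) (f : G → F) (hf : D r f) : D r (fun x => f (x + v)) := by
  have := D_comp (AddMonoidHom.id G) v r f hf
  simpa [add_comm] using this

lemma D_mul : ∀ (n a b : ℕ) (f g : G → F), a + b = n → D (a + 1) f → D (b + 1) g →
    D (a + b + 1) (fun x => f x * g x) := by
  intro n
  induction n with
  | zero =>
    intro a b f g h hf hg v
    obtain rfl : a = 0 := by omega
    obtain rfl : b = 0 := by omega
    intro x
    have h1 := hf v x
    have h2 := hg v x
    simp only at h1 h2 ⊢
    linear_combination g (x + v) * h1 + f x * h2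
  | succ n ih =>
    intro a b f g h hf hg v
    have e : (fun x => f (x + v) * g (x + v) - f x * g x)
      = fun x => (f (x + v) - f x) * g (x + v) + f x * (g (x + v) - g x) := by
      funext x; ring
    rw [e]
    apply D_add
    · rcases a with _ | a
      · have h1 : ∀ x, f (x + v) - f x = 0 := hf v
        simp only [h1, zero_mul]
        exact D_zero _
      · have := ih a b _ _ (by omega) (hf v) (D_shift v _ g hg)
        rwa [show a + 1 + b = a + b + 1 by omega]
    · rcases b with _ | b
      · have h1 : ∀ x, g (x + v) - g x = 0 := hg v
        simp only [h1, mul_zero]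
        exact D_zero _
      · exact ih a b _ _ (by omega) hf (hg v)

lemma D_sum {ι : Type*} (s : Finset ι) (r : ℕ) (f : ι → G → F) (h : ∀ i ∈ s, D r (f i)) :
    D r (fun x => ∑ i ∈ s, f i x) := by
  classical
  induction s using Finset.induction_on with
  | empty => simpa using D_zero r
  | insert a s ha ih =>
    simp only [Finset.sum_insert ha]
    exact D_add _ _ _ (h a (by simp)) (ih fun i hi => h i (by simp [hi]))

lemma D_pow (f : G → F) (hf : D 2 f) (k : ℕ) : D (k + 1) (fun x => f x ^ k) := by
  induction k with
  | zero => simpa using D_const 0 (1 : F)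
  | succ k ih =>
    simp only [pow_succ]
    exact D_mul _ k 1 _ _ rfl ih hf

lemma D_prod {ι : Type*} (s : Finset ι) (e : ι → ℕ) (f : ι → G → F)
    (h : ∀ i, D (e i + 1) (f i)) :
    D ((∑ i ∈ s, e i) + 1) (fun x => ∏ i ∈ s, f i x) := by
  classical
  induction s using Finset.induction_on with
  | empty => simpa using D_const 0 (1 : F)
  | insert a s ha ih =>
    simp only [Finset.sum_insert ha, Finset.prod_insert ha]
    exact D_mul _ _ _ _ _ rfl (h a) ih

lemma D_poly {m r : ℕ} (P : MvPolynomial (Fin m) F) (hP : P.totalDegree ≤ r) :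
    D (r + 1) (fun x : Fin m → F => MvPolynomial.eval x P) := by
  have : (fun x : Fin m → F => MvPolynomial.eval x P)
      = fun x => ∑ d ∈ P.support, P.coeff d * ∏ i, x i ^ d i := by
    funext x; exact MvPolynomial.eval_eq' x P
  rw [this]
  apply D_sum
  intro d hd
  have h1 : D ((∑ i, d i) + 1) (fun x : Fin m → F => ∏ i, x i ^ d i) := by
    apply D_prod
    intro i
    apply D_pow
    intro v w x
    simp
  have h2 := D_mul _ 0 _ _ _ rfl (D_const 0 (P.coeff d)) h1
  refine D_mono ?_ h2
  have := MvPolynomial.le_totalDegree hd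
  rw [Finsupp.sum_fintype _ _ (by simp)] at this
  omega
end D

/-! counting -/
section cnt
variable {V : Type} [Finite V]

noncomputable def Wt {F : Type} [Field F] {V : Type} (f : V → F) : ℕ := Set.ncard {z | f z ≠ 0}
noncomputable def cn {F : Type} [Field F] {V : Type} (f : V → F) (P : V → Prop) : ℕ :=
  Set.ncard {z | f z ≠ 0 ∧ P z}

lemma cn_congr {f : V → F} {P Q : V → Prop} (h : ∀ z, f z ≠ 0 → (P z ↔ Q z)) : cn f P = cn f Q := by
  unfold cn
  congr 1
  ext z
  simp only [Set.mem_ofPred_eq]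
  constructor
  · rintro ⟨a, b⟩; exact ⟨a, (h z a).1 b⟩
  · rintro ⟨a, b⟩; exact ⟨a, (h z a).2 b⟩

lemma cn_zero {f : V → F} {P : V → Prop} : cn f P = 0 ↔ ∀ z, P z → f z = 0 := by
  unfold cn
  rw [Set.ncard_eq_zero (Set.toFinite _), Set.eq_empty_iff_forall_notMem]
  simp only [Set.mem_ofPred_eq, not_and]
  exact forall_congr' fun z => by tauto

lemma Wt_zero {f : V → F} : Wt f = 0 ↔ ∀ z, f z = 0 := by
  unfold Wt
  rw [Set.ncard_eq_zero (Set.toFinite _), Set.eq_empty_iff_forall_notMem]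
  simp

lemma Wt_eq (f : V → F) : Wt f = cn f (fun _ => True) := by simp [Wt, cn]

lemma cn_split (f : V → F) (P : V → Prop) (g : V → F) :
    cn f P = cn f (fun z => P z ∧ g z = 0) + cn f (fun z => P z ∧ g z = 1)
      + cn f (fun z => P z ∧ g z = -1) := by
  unfold cn
  rw [← Set.ncard_union_eq, ← Set.ncard_union_eq]
  · congr 1
    ext z
    simp only [Set.mem_ofPred_eq, Set.mem_union]
    have := tri (g z)
    tauto
  · rw [Set.disjoint_left]
    rintro z (⟨_, _, h⟩ | ⟨_, _, h⟩) ⟨_, _, h'⟩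
    · rw [h] at h'
      exact one_ne_zero (neg_eq_zero.1 h'.symm)
    · rw [h] at h'
      exact two_ne h'
  · rw [Set.disjoint_left]
    rintro z ⟨_, _, h⟩ ⟨_, _, h'⟩
    rw [h] at h'
    exact zero_ne_one h'

lemma Wt_split (f : V → F) (g : V → F) :
    Wt f = cn f (fun z => g z = 0) + cn f (fun z => g z = 1) + cn f (fun z => g z = -1) := by
  rw [Wt_eq, cn_split f _ g]
  simp
end cnt
end RMx

namespace RMx
variable {F : Type} [Field F] [Fintype F] [hF : Fact (Fintype.card F = 3)]
variable {V : Type} [AddCommGroup V] [Module F V] [Finite V]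

def Aff {F : Type} [Field F] {V : Type} [AddCommGroup V] [Module F V] (x : V → F) : Prop :=
  ∃ l : V →ₗ[F] F, ∃ c : F, ∀ z, x z = l z + c

def PI {F : Type} [Field F] {V : Type} [AddCommGroup V] [Module F V] (x y : V → F) : Prop :=
  Aff x ∧ Aff y ∧ ∀ a b, ∃ z, x z = a ∧ y z = b

lemma Aff.lin {x y : V → F} (hx : Aff x) (hy : Aff y) (s t c : F) :
    Aff (fun z => s * x z + t * y z + c) := by
  obtain ⟨l, a, hl⟩ := hx
  obtain ⟨k, b, hk⟩ := hy
  refine ⟨s • l + t • k, s * a + t * b + c, fun z => ?_⟩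
  simp [hl, hk]; ring

lemma Aff.shift {x : V → F} (hx : Aff x) (c : F) : Aff (fun z => x z + c) := by
  simpa using hx.lin hx 1 0 c

lemma Aff.neg {x : V → F} (hx : Aff x) : Aff (fun z => - x z) := by
  simpa using hx.lin hx (-1) 0 0

lemma PI.s1 {x y : V → F} (h : PI x y) : Function.Surjective x := fun a => by
  obtain ⟨z, h, _⟩ := h.2.2 a 0; exact ⟨z, h⟩

lemma PI.swap {x y : V → F} (h : PI x y) : PI y x := ⟨h.2.1, h.1, fun a b => by
  obtain ⟨z, h, h'⟩ := h.2.2 b a; exact ⟨z, h', h⟩⟩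

/-- `y` may be changed by adding a multiple of `x` and a constant. -/
lemma PI.mod {x y : V → F} (h : PI x y) (s c : F) : PI x (fun z => y z + s * x z + c) := by
  refine ⟨h.1, ?_, fun a b => ?_⟩
  · simpa using h.2.1.lin h.1 1 s c
  · obtain ⟨z, h, h'⟩ := h.2.2 a (b - s * a - c)
    exact ⟨z, h, by simp only [h, h']; ring⟩

lemma PI.negl {x y : V → F} (h : PI x y) : PI (fun z => - x z) y := by
  refine ⟨h.1.neg, h.2.1, fun a b => ?_⟩
  obtain ⟨z, h, h'⟩ := h.2.2 (-a) b
  exact ⟨z, by simp [h], h'⟩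

lemma PI.shl {x y : V → F} (h : PI x y) (c : F) : PI (fun z => x z + c) y := by
  refine ⟨h.1.shift c, h.2.1, fun a b => ?_⟩
  obtain ⟨z, h, h'⟩ := h.2.2 (a - c) b
  exact ⟨z, by simp [h], h'⟩

lemma cardF : Nat.card F = 3 := by rw [Nat.card_eq_fintype_card]; exact hF.out

lemma card_pow (W : Type) [AddCommGroup W] [Module F W] [Finite W] :
    Nat.card W = 3 ^ Module.finrank F W := by
  rw [Module.natCard_eq_pow_finrank (K := F), cardF]

/-- hyperplane data -/
structure HD {F : Type} [Field F] {V : Type} [AddCommGroup V] [Module F V] (x : V → F)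
    (W : Submodule F V) (p : V) : Prop where
  card : 3 * Nat.card W = Nat.card V
  rank : Module.finrank F W + 1 = Module.finrank F V
  mem : ∀ z, x z = 0 ↔ z - p ∈ W
  inv : ∀ z w, w ∈ W → x (z + w) = x z
  add : ∀ z v w, x (z + v) - x z = x (w + v) - x w

lemma HD.zero {x : V → F} {W : Submodule F V} {p : V} (h : HD x W p) (w : W) : x (p + w) = 0 := by
  rw [h.mem]; simp

lemma hd_exists {x : V → F} (hx : Aff x) (hs : Function.Surjective x) :
    ∃ (W : Submodule F V) (p : V), HD x W p ∧
      ∀ y' : W → F, Aff y' → ∃ y : V → F, Aff y ∧ (Function.Surjective y' → PI x y) ∧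
        ∀ w : W, y (p + w) = y' w := by
  obtain ⟨l, c, hl⟩ := id hx
  obtain ⟨p, hp⟩ := hs 0
  have hls : Function.Surjective l := fun a => by
    obtain ⟨z, hz⟩ := hs (a + c)
    exact ⟨z, by rw [hl] at hz; linear_combination hz⟩
  have hr : Module.finrank F (LinearMap.ker l) + 1 = Module.finrank F V := by
    have h1 := LinearMap.finrank_range_add_finrank_ker l
    rw [LinearMap.range_eq_top.2 hls, finrank_top, Module.finrank_self] at h1
    omega
  refine ⟨LinearMap.ker l, p, ⟨?_, hr, ?_, ?_, ?_⟩, ?_⟩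
  · rw [card_pow (F := F) V, ← hr, card_pow (F := F) (LinearMap.ker l), pow_succ]; ring
  · intro z
    rw [LinearMap.mem_ker, map_sub, hl]
    rw [hl] at hp
    constructor
    · intro h; linear_combination h - hp
    · intro h; linear_combination h + hp
  · intro z w hw
    rw [LinearMap.mem_ker] at hw
    simp [hl, hw]
  · intro z v w
    simp [hl]
  · rintro y' ⟨k, d, hk⟩
    obtain ⟨K, hK⟩ := LinearMap.exists_extend k
    have hKw : ∀ w : LinearMap.ker l, K w = k w := fun w => by rw [← hK]; rfl
    have hya : Aff (fun z => K z + (d - K p)) := ⟨K, d - K p, fun z => rfl⟩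
    refine ⟨fun z => K z + (d - K p), hya, ?_, ?_⟩
    · intro hsy
      refine ⟨hx, hya, fun a b => ?_⟩
      obtain ⟨z, hz⟩ := hs a
      obtain ⟨w, hw⟩ := hsy (b - K z + K p)
      refine ⟨z + w, ?_, ?_⟩
      · have hw : l w = 0 := LinearMap.mem_ker.1 w.2
        rw [hl, map_add, hw, add_zero, ← hl, hz]
      · rw [hk] at hw
        simp only [map_add, hKw]
        linear_combination hw
    · intro w
      simp only [hk, map_add, hKw]; ring

lemma cn_restr (f : V → F) (W : Submodule F V) (p : V) (Q : V → Prop) :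
    cn (fun w : W => f (p + w)) (fun w => Q (p + w)) = cn f (fun z => z - p ∈ W ∧ Q z) := by
  unfold cn
  apply Set.ncard_congr (fun (w : W) _ => p + (w : V))
  · rintro w ⟨h1, h2⟩
    exact ⟨h1, by simp, h2⟩
  · intro a b _ _ h
    exact Subtype.ext (add_left_cancel h)
  · rintro b ⟨h1, h2, h3⟩
    exact ⟨⟨b - p, h2⟩, by simpa using ⟨h1, h3⟩, by simp⟩

lemma Wt_restr (f : V → F) (W : Submodule F V) (p : V) :
    Wt (fun w : W => f (p + w)) = cn f (fun z => z - p ∈ W) := by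
  rw [Wt_eq]
  have := cn_restr f W p (fun _ => True)
  simpa using this

lemma HD.cn {x : V → F} {W : Submodule F V} {p : V} (h : HD x W p) (f : V → F) (Q : V → Prop) :
    cn (fun w : W => f (p + w)) (fun w => Q (p + w)) = cn f (fun z => x z = 0 ∧ Q z) := by
  rw [cn_restr]
  simp only [h.mem]

lemma HD.wt {x : V → F} {W : Submodule F V} {p : V} (h : HD x W p) (f : V → F) :
    Wt (fun w : W => f (p + w)) = RMx.cn f (fun z => x z = 0) := by
  rw [Wt_restr]
  simp only [h.mem]

lemma D_restr {r : ℕ} {f : V → F} (hf : D r f) (W : Submodule F V) (p : V) :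
    D r (fun w : W => f (p + w)) :=
  D_comp W.subtype.toAddMonoidHom p r f hf

lemma HD.drop1 {x : V → F} {W : Submodule F V} {p : V} (h : HD x W p) {r : ℕ} {f : V → F}
    (hf : D (r + 1) f) (hs : Function.Surjective x) (a : F)
    (h0 : ∀ z, x z = a → f z = 0) : D r (fun w : W => f (p + w)) := by
  obtain ⟨q, hq⟩ := hs a
  have := D_restr (hf (p - q)) W q
  convert this using 2 with w
  rw [h0 (q + w) (by rw [h.inv _ _ w.2, hq])]
  rw [sub_zero]
  congr 1
  abel

lemma HD.drop2 {x : V → F} {W : Submodule F V} {p : V} (h : HD x W p) {r : ℕ} {f : V → F}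
    (hf : D (r + 2) f) (hs : Function.Surjective x)
    (h0 : ∀ z, x z ≠ 0 → f z = 0) : D r (fun w : W => f (p + w)) := by
  obtain ⟨q, hq⟩ := hs 1
  have := D_restr (hf (p - q) (p - q)) W (q - (p - q))
  convert this using 2 with w
  have hp : x p = 0 := by rw [h.mem]; simp
  have e1 : f (q - (p - q) + w) = 0 := by
    apply h0
    rw [h.inv _ _ w.2]
    have := h.add (q - (p - q)) (p - q) q
    rw [sub_add_cancel, add_sub_cancel, hp, hq] at this
    have h3 : (3 : F) = 0 := three_zero
    intro h4
    rw [h4] at this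
    apply two_ne (F := F)
    linear_combination this
  have e2 : f (q - (p - q) + w + (p - q)) = 0 := by
    apply h0
    rw [show q - (p - q) + w + (p - q) = q + (w : V) by abel, h.inv _ _ w.2, hq]
    exact one_ne_zero
  simp only [e1, e2, sub_zero]
  congr 1
  abel

def Bd (F : Type) [Field F] (n : ℕ) : Prop :=
  ∀ (V : Type) [AddCommGroup V] [Module F V] [Finite V], Module.finrank F V = n →
  ∀ (t : ℕ) (f : V → F), Wt f ≠ 0 → (D (2 * t + 1) f → Nat.card V ≤ Wt f * 3 ^ t) ∧
    (D (2 * t + 2) f → 2 * Nat.card V ≤ Wt f * 3 ^ (t + 1))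

section
variable {x : V → F} {f : V → F} {t : ℕ}

lemma hbE0 (hx : Aff x) (hs : Function.Surjective x)
    (B : Bd F (Module.finrank F V - 1)) (h : D (2 * t + 1) f) : cn f (fun z => x z = 0) = 0 ∨
    Nat.card V ≤ 3 * cn f (fun z => x z = 0) * 3 ^ t := by
  obtain ⟨W, p, hd, -⟩ := hd_exists hx hs
  rw [← hd.wt, or_iff_not_imp_left]
  intro h0
  have := (B W (by have := hd.rank; omega) t _ h0).1 (D_restr h _ _)
  rw [← hd.card]; linarith

lemma hbO0 (hx : Aff x) (hs : Function.Surjective x)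
    (B : Bd F (Module.finrank F V - 1)) (h : D (2 * t + 2) f) : cn f (fun z => x z = 0) = 0 ∨
    2 * Nat.card V ≤ 3 * cn f (fun z => x z = 0) * 3 ^ (t + 1) := by
  obtain ⟨W, p, hd, -⟩ := hd_exists hx hs
  rw [← hd.wt, or_iff_not_imp_left]
  intro h0
  have := (B W (by have := hd.rank; omega) t _ h0).2 (D_restr h _ _)
  rw [← hd.card]; linarith

lemma hbE1 (hx : Aff x) (hs : Function.Surjective x)
    (B : Bd F (Module.finrank F V - 1)) (h : D (2 * t + 2) f) (a : F) (ha : cn f (fun z => x z = a) = 0) :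
    cn f (fun z => x z = 0) = 0 ∨
    Nat.card V ≤ 3 * cn f (fun z => x z = 0) * 3 ^ t := by
  obtain ⟨W, p, hd, -⟩ := hd_exists hx hs
  rw [← hd.wt, or_iff_not_imp_left]
  intro h0
  have := (B W (by have := hd.rank; omega) t _ h0).1 (hd.drop1 h hs a (cn_zero.1 ha))
  rw [← hd.card]; linarith

lemma hbO1 (hx : Aff x) (hs : Function.Surjective x)
    (B : Bd F (Module.finrank F V - 1)) (h : D (2 * t + 3) f) (a : F) (ha : cn f (fun z => x z = a) = 0) :
    cn f (fun z => x z = 0) = 0 ∨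
    2 * Nat.card V ≤ 3 * cn f (fun z => x z = 0) * 3 ^ (t + 1) := by
  obtain ⟨W, p, hd, -⟩ := hd_exists hx hs
  rw [← hd.wt, or_iff_not_imp_left]
  intro h0
  have := (B W (by have := hd.rank; omega) t _ h0).2 (hd.drop1 h hs a (cn_zero.1 ha))
  rw [← hd.card]; linarith

lemma hbE2 (hx : Aff x) (hs : Function.Surjective x)
    (B : Bd F (Module.finrank F V - 1)) (h : D (2 * t + 3) f) (ha : ∀ z, x z ≠ 0 → f z = 0) :
    cn f (fun z => x z = 0) = 0 ∨
    Nat.card V ≤ 3 * cn f (fun z => x z = 0) * 3 ^ t := by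
  obtain ⟨W, p, hd, -⟩ := hd_exists hx hs
  rw [← hd.wt, or_iff_not_imp_left]
  intro h0
  have := (B W (by have := hd.rank; omega) t _ h0).1 (hd.drop2 h hs ha)
  rw [← hd.card]; linarith

lemma hbO2 (hx : Aff x) (hs : Function.Surjective x)
    (B : Bd F (Module.finrank F V - 1)) (h : D (2 * t + 4) f) (ha : ∀ z, x z ≠ 0 → f z = 0) :
    cn f (fun z => x z = 0) = 0 ∨
    2 * Nat.card V ≤ 3 * cn f (fun z => x z = 0) * 3 ^ (t + 1) := by
  obtain ⟨W, p, hd, -⟩ := hd_exists hx hs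
  rw [← hd.wt, or_iff_not_imp_left]
  intro h0
  have := (B W (by have := hd.rank; omega) t _ h0).2 (hd.drop2 h hs ha)
  rw [← hd.card]; linarith
end
end RMx

namespace RMx
variable {F : Type} [Field F] [Fintype F] [hF : Fact (Fintype.card F = 3)]
variable {V : Type} [AddCommGroup V] [Module F V] [Finite V]

lemma cn_shift (f : V → F) (x : V → F) (c : F) :
    cn f (fun z => x z + c = 0) = cn f (fun z => x z = -c) :=
  cn_congr fun z _ => by rw [eq_neg_iff_add_eq_zero]

lemma surj_shift {x : V → F} (hs : Function.Surjective x) (c : F) :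
    Function.Surjective (fun z => x z + c) := fun a => by
  obtain ⟨z, hz⟩ := hs (a - c); exact ⟨z, by simp [hz]⟩

lemma three_pat (P : F → Prop) : 
    (∀ a, ¬ P a) ∨ (∃ a, P a ∧ ∀ b, b ≠ a → ¬ P b) ∨ (∃ a, ¬ P a ∧ ∀ b, b ≠ a → P b) ∨ ∀ a, P a := by
  by_cases h0 : P 0 <;> by_cases h1 : P 1 <;> by_cases h2 : P (-1)
  · exact Or.inr (Or.inr (Or.inr fun a => by rcases tri a with h | h | h <;> rwa [h]))
  · refine Or.inr (Or.inr (Or.inl ⟨-1, h2, fun b hb => ?_⟩)); rcases tri b with h | h | h <;> simp_all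
  · refine Or.inr (Or.inr (Or.inl ⟨1, h1, fun b hb => ?_⟩)); rcases tri b with h | h | h <;> simp_all
  · refine Or.inr (Or.inl ⟨0, h0, fun b hb => ?_⟩); rcases tri b with h | h | h <;> simp_all
  · refine Or.inr (Or.inr (Or.inl ⟨0, h0, fun b hb => ?_⟩)); rcases tri b with h | h | h <;> simp_all
  · refine Or.inr (Or.inl ⟨1, h1, fun b hb => ?_⟩); rcases tri b with h | h | h <;> simp_all
  · refine Or.inr (Or.inl ⟨-1, h2, fun b hb => ?_⟩); rcases tri b with h | h | h <;> simp_all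
  · exact Or.inl (fun a => by rcases tri a with h | h | h <;> rwa [h])

lemma Wt_split' (f : V → F) (x : V → F) (c : F) :
    Wt f = cn f (fun z => x z = c) + cn f (fun z => x z = c + 1) + cn f (fun z => x z = c - 1) := by
  rw [Wt_split f (fun z => x z - c)]
  congr 1
  · congr 1
    · exact cn_congr fun z _ => sub_eq_zero
    · exact cn_congr fun z _ => ⟨fun h => by linear_combination h, fun h => by linear_combination h⟩
  · exact cn_congr fun z _ => ⟨fun h => by linear_combination h, fun h => by linear_combination h⟩

lemma exists_aff (h : 0 < Module.finrank F V) : ∃ x : V → F, Aff x ∧ Function.Surjective x := by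
  have : Nontrivial V := Module.finrank_pos_iff.1 h
  obtain ⟨v, hv⟩ := exists_ne (0 : V)
  obtain ⟨g, hg⟩ := Module.Projective.exists_dual_ne_zero F hv
  refine ⟨g, ⟨g, 0, by simp⟩, fun a => ⟨(a * (g v)⁻¹) • v, ?_⟩⟩
  simp [hg]

theorem bd_all (n : ℕ) : Bd F n := by
  induction n with
  | zero =>
    intro V _ _ _ hV t f hf
    have : Nat.card V = 1 := by rw [card_pow (F := F), hV, pow_zero]
    have h1 : 1 ≤ 3 ^ t := Nat.one_le_pow _ _ (by norm_num)
    rw [this]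
    have h2 : 1 ≤ Wt f := by omega
    constructor <;> intro _ 
    · nlinarith
    · rw [pow_succ]; nlinarith
  | succ n ih =>
    intro V _ _ _ hV t f hf
    have B : Bd F (Module.finrank F V - 1) := by rw [hV]; exact ih
    obtain ⟨x, hx, hs⟩ := exists_aff (F := F) (V := V) (by omega)
    have S := fun c => Wt_split' f x c
    have k : ∀ c, cn f (fun z => x z = c) = cn f (fun z => x z + (-c) = 0) := fun c => by
      rw [cn_shift, neg_neg]
    have T : 0 < 3 ^ t := by positivity
    -- patterns
    rcases three_pat (fun c : F => cn f (fun z => x z = c) = 0) with h | ⟨a, h1, h2⟩ | ⟨a, h1, h2⟩ | h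
    · have S0 := S 0
      constructor
      · intro hD
        have := fun c => (hbE0 (hx.shift (-c)) (surj_shift hs _) B hD).resolve_left (by rw [← k]; exact h c)
        simp only [← k] at this
        have a0 := this 0; have a1 := this (0 + 1); have a2 := this (0 - 1)
        rw [S0]; nlinarith
      · intro hD
        have := fun c => (hbO0 (hx.shift (-c)) (surj_shift hs _) B hD).resolve_left (by rw [← k]; exact h c)
        simp only [← k] at this
        have a0 := this 0; have a1 := this (0 + 1); have a2 := this (0 - 1)
        rw [S0]; nlinarith
    · have S0 := S a
      rw [h1] at S0
      have m1 : cn f (fun z => x z + -(a+1) = -1) = 0 := by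
        rw [← h1]; exact cn_congr fun z _ => ⟨fun h => by linear_combination h, fun h => by linear_combination h⟩
      have m2 : cn f (fun z => x z + -(a-1) = 1) = 0 := by
        rw [← h1]; exact cn_congr fun z _ => ⟨fun h => by linear_combination h, fun h => by linear_combination h⟩
      have n1 := h2 (a+1) (by simp)
      have n2 := h2 (a-1) (by simp)
      constructor
      · intro hD
        rcases t with _ | t
        · exfalso
          obtain ⟨W, p, hd, -⟩ := hd_exists (hx.shift (-(a+1))) (surj_shift hs _)
          have := hd.drop1 hD (surj_shift hs _) _ (cn_zero.1 m1)
          apply n1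
          rw [k, ← hd.wt]
          exact Wt_zero.2 this
        · have a1 := (hbO1 (hx.shift (-(a+1))) (surj_shift hs _) B hD _ m1).resolve_left (by rw [← k]; exact n1)
          have a2 := (hbO1 (hx.shift (-(a-1))) (surj_shift hs _) B hD _ m2).resolve_left (by rw [← k]; exact n2)
          simp only [← k] at a1 a2
          rw [S0]; nlinarith
      · intro hD
        have a1 := (hbE1 (hx.shift (-(a+1))) (surj_shift hs _) B hD _ m1).resolve_left (by rw [← k]; exact n1)
        have a2 := (hbE1 (hx.shift (-(a-1))) (surj_shift hs _) B hD _ m2).resolve_left (by rw [← k]; exact n2)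
        simp only [← k] at a1 a2
        rw [S0, pow_succ]; nlinarith
    · have S0 := S a
      rw [h2 (a+1) (by simp), h2 (a-1) (by simp)] at S0
      have hz : ∀ z, x z + -a ≠ 0 → f z = 0 := fun z hz =>
        cn_zero.1 (h2 (x z) (fun h => hz (by rw [h]; ring))) z rfl
      rw [k] at h1
      constructor
      · intro hD
        rcases t with _ | t
        · exfalso
          obtain ⟨W, p, hd, -⟩ := hd_exists (hx.shift (-a)) (surj_shift hs _)
          have := hd.drop2 (D_mono1 _ _ hD) (surj_shift hs _) hz
          apply h1
          rw [← hd.wt]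
          exact Wt_zero.2 this
        · have a1 := (hbE2 (hx.shift (-a)) (surj_shift hs _) B hD hz).resolve_left h1
          simp only [← k] at a1
          rw [S0, pow_succ]; nlinarith
      · intro hD
        rcases t with _ | t
        · exfalso
          obtain ⟨W, p, hd, -⟩ := hd_exists (hx.shift (-a)) (surj_shift hs _)
          have := hd.drop2 hD (surj_shift hs _) hz
          apply h1
          rw [← hd.wt]
          exact Wt_zero.2 this
        · have a1 := (hbO2 (hx.shift (-a)) (surj_shift hs _) B hD hz).resolve_left h1
          simp only [← k] at a1
          rw [S0, pow_succ]; nlinarith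
    · exfalso
      apply hf
      rw [S 0, h, h, h]

lemma EB {t : ℕ} {f : V → F} (hf : Wt f ≠ 0) (h : D (2 * t + 1) f) : Nat.card V ≤ Wt f * 3 ^ t :=
  (bd_all _ V rfl t f hf).1 h
lemma OB {t : ℕ} {f : V → F} (hf : Wt f ≠ 0) (h : D (2 * t + 2) f) :
    2 * Nat.card V ≤ Wt f * 3 ^ (t + 1) :=
  (bd_all _ V rfl t f hf).2 h

/-- Lemma M -/
lemma lemM (f : V → F) (C c : ℕ) (hC : 0 < C) (h0 : ∃ z, f z = 0)
    (H : ∀ (W : Submodule F V) (p : V), cn f (fun z => z - p ∈ W) ≠ 0 →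
      c * Nat.card W ≤ C * cn f (fun z => z - p ∈ W)) :
    ∃ (W : Submodule F V) (p : V), cn f (fun z => z - p ∈ W) = 0 ∧
      3 * c * Nat.card V ≤ 2 * C * Wt f + 3 * c * Nat.card W := by
  classical
  let X : Set (Submodule F V) := {W | ∃ p, cn f (fun z => z - p ∈ W) = 0}
  have hX : X.Nonempty := by
    obtain ⟨z, hz⟩ := h0
    refine ⟨⊥, z, ?_⟩
    rw [cn_zero]
    intro y hy
    rw [Submodule.mem_bot, sub_eq_zero] at hy
    rw [hy, hz]
  obtain ⟨W, hW⟩ := (Set.toFinite X).exists_maximal hX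
  obtain ⟨p, hp⟩ := hW.1
  refine ⟨W, p, hp, ?_⟩
  have := Fintype.ofFinite V
  let s : Finset V := Finset.univ.filter (fun u => u ∉ W)
  let T : Finset V := Finset.univ.filter (fun z => f z ≠ 0)
  let r : V → V → Prop := fun u z => z - p ∈ W ⊔ Submodule.span F {u}
  let w := Nat.card W
  have hwpos : 0 < w := Nat.card_pos
  let m0 := (3 * c * w + (C - 1)) / C
  have hm0 : 3 * c * w ≤ C * m0 := by
    have h1 := Nat.div_add_mod (3 * c * w + (C - 1)) C
    have h2 := Nat.mod_lt (3 * c * w + (C - 1)) hC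
    show _ ≤ C * ((3 * c * w + (C - 1)) / C)
    omega
  have key : s.card * m0 ≤ T.card * (2 * w) := by
    apply Finset.card_mul_le_card_mul r
    · intro u hu
      have hu : u ∉ W := by simpa [s] using hu
      have hlt : W < W ⊔ Submodule.span F {u} := by
        refine lt_of_le_of_ne le_sup_left fun h => hu ?_
        rw [h]
        exact Submodule.mem_sup_right (Submodule.mem_span_singleton_self u)
      have hne : cn f (fun z => z - p ∈ W ⊔ Submodule.span F {u}) ≠ 0 := fun h =>
        absurd (hW.2 (show W ⊔ Submodule.span F {u} ∈ X from ⟨p, h⟩) hlt.le) (not_le_of_gt hlt)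
      have h1 := H _ p hne
      have h2 : 3 * w ≤ Nat.card (W ⊔ Submodule.span F {u} : Submodule F V) := by
        have := Submodule.finrank_lt_finrank_of_lt hlt
        show 3 * Nat.card W ≤ _
        rw [card_pow (F := F) W, card_pow (F := F) (W ⊔ Submodule.span F {u} : Submodule F V), mul_comm, ← pow_succ]
        exact Nat.pow_le_pow_right (by norm_num) this
      have h3 : (T.bipartiteAbove r u).card = cn f (fun z => z - p ∈ W ⊔ Submodule.span F {u}) := by
        unfold cn
        rw [← Set.ncard_coe_finset]
        congr 1
        ext z
        simp [Finset.bipartiteAbove, T, r]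
      rw [h3]
      have h4 : 3 * c * w ≤ C * cn f (fun z => z - p ∈ W ⊔ Submodule.span F {u}) := by nlinarith
      apply Nat.le_of_lt_succ
      apply (Nat.div_lt_iff_lt_mul hC).2
      have : (cn f (fun z => z - p ∈ W ⊔ Submodule.span F {u})).succ * C = C * cn f (fun z => z - p ∈ W ⊔ Submodule.span F {u}) + C := by
        rw [Nat.succ_mul, mul_comm]
      rw [this]
      omega
    · intro z hz
      have hz : f z ≠ 0 := by simpa [T] using hz
      have hzW : z - p ∉ W := fun h => hz (cn_zero.1 hp z h)
      let WF : Finset V := Finset.univ.filter (fun u => u ∈ W)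
      have hWF : WF.card = w := by
        show _ = Nat.card W
        rw [Nat.card_eq_fintype_card, Fintype.card_subtype]
      have hsub : s.bipartiteBelow r z ⊆ WF.image (fun v => (z - p) + v) ∪ WF.image (fun v => -(z - p) + v) := by
        intro u hu
        simp only [Finset.bipartiteBelow, r, s, Finset.mem_filter, Finset.mem_univ, true_and] at hu
        obtain ⟨hu1, hu2⟩ := hu
        obtain ⟨y, hy, y', hy', e⟩ := Submodule.mem_sup.1 hu2
        obtain ⟨a, rfl⟩ := Submodule.mem_span_singleton.1 hy'
        simp only [Finset.mem_union, Finset.mem_image, WF, Finset.mem_filter, Finset.mem_univ, true_and]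
        rcases tri a with rfl | rfl | rfl
        · exfalso; apply hzW; rw [← e]; simpa using hy
        · left; refine ⟨-y, W.neg_mem hy, ?_⟩; rw [← e, one_smul]; abel
        · right; refine ⟨y, hy, ?_⟩; rw [← e, neg_one_smul]; abel
      calc _ ≤ _ := Finset.card_le_card hsub
        _ ≤ _ := Finset.card_union_le _ _
        _ ≤ WF.card + WF.card := Nat.add_le_add Finset.card_image_le Finset.card_image_le
        _ = 2 * w := by rw [hWF]; ring
  have hT : T.card = Wt f := by
    unfold Wt
    rw [← Set.ncard_coe_finset]
    congr 1
    ext z; simp [T]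
  have hs : s.card + w = Nat.card V := by
    have h1 := Finset.card_filter_add_card_filter_not (s := (Finset.univ : Finset V)) (fun u => u ∈ W)
    have h2 : w = (Finset.univ.filter (fun u => u ∈ W)).card := by
      show Nat.card W = _
      rw [Nat.card_eq_fintype_card, Fintype.card_subtype]
    rw [Nat.card_eq_fintype_card, ← Finset.card_univ, ← h1, ← h2, add_comm]
  rw [hT] at key
  have h5 : s.card * (3 * c * w) ≤ C * (Wt f * (2 * w)) := by
    calc _ ≤ s.card * (C * m0) := Nat.mul_le_mul_left _ hm0
      _ = C * (s.card * m0) := by ring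
      _ ≤ _ := Nat.mul_le_mul_left _ key
  have h6 : s.card * (3 * c) ≤ C * (Wt f * 2) := by
    apply Nat.le_of_mul_le_mul_right _ hwpos
    calc _ = s.card * (3 * c * w) := by ring
      _ ≤ _ := h5
      _ = _ := by ring
  rw [← hs]
  show _ ≤ _ + 3 * c * w
  linarith

lemma HE {t : ℕ} {f : V → F} (h : D (2 * t + 1) f) (W : Submodule F V) (p : V)
    (h0 : cn f (fun z => z - p ∈ W) ≠ 0) : 1 * Nat.card W ≤ 3 ^ t * cn f (fun z => z - p ∈ W) := by
  rw [← Wt_restr] at h0 ⊢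
  have := EB h0 (D_restr h W p)
  linarith

lemma HO {t : ℕ} {f : V → F} (h : D (2 * t + 2) f) (W : Submodule F V) (p : V)
    (h0 : cn f (fun z => z - p ∈ W) ≠ 0) : 2 * Nat.card W ≤ 3 ^ (t + 1) * cn f (fun z => z - p ∈ W) := by
  rw [← Wt_restr] at h0 ⊢
  have := OB h0 (D_restr h W p)
  linarith

/-- codimension one -/
lemma codim1 {W : Submodule F V} (p : V) (hW : W ≠ ⊤) (hc : Nat.card V < 9 * Nat.card W) :
    ∃ x : V → F, Aff x ∧ Function.Surjective x ∧ ∀ z, x z = 0 → z - p ∈ W := by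
  have h1 := Submodule.finrank_quotient_add_finrank W
  have h2 : Module.finrank F (V ⧸ W) ≠ 0 := by
    intro h
    apply hW
    apply Submodule.eq_top_of_finrank_eq
    omega
  have h3 : Module.finrank F (V ⧸ W) = 1 := by
    rw [card_pow (F := F) V, card_pow (F := F) W, show 9 = 3 ^ 2 by norm_num, ← pow_add] at hc
    have := (Nat.pow_lt_pow_iff_right (by norm_num)).1 hc
    omega
  let b := Module.finBasisOfFinrankEq F (V ⧸ W) h3
  refine ⟨fun z => b.repr (W.mkQ (z - p)) 0, ⟨(b.coord 0).comp W.mkQ, - b.repr (W.mkQ p) 0, fun z => by simp [sub_eq_add_neg]⟩, ?_, ?_⟩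
  · intro a
    obtain ⟨z, hz⟩ := W.mkQ_surjective (a • b 0)
    refine ⟨z + p, ?_⟩
    simp only [add_sub_cancel_right, hz]
    simp
  · intro z hz
    rw [← Submodule.Quotient.mk_eq_zero, ← Submodule.mkQ_apply]
    apply b.repr.map_eq_zero_iff.1
    refine Finsupp.ext fun i => ?_
    rw [Subsingleton.elim i 0]; exact hz

lemma codim2 {W : Submodule F V} (p : V) (hW : W ≠ ⊤) (hc : Nat.card V ≤ 9 * Nat.card W) :
    (∃ x : V → F, Aff x ∧ Function.Surjective x ∧ ∀ z, x z = 0 → z - p ∈ W) ∨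
    ∃ x y : V → F, PI x y ∧ ∀ z, x z = 0 → y z = 0 → z - p ∈ W := by
  rcases Nat.lt_or_eq_of_le hc with hc | hc
  · exact Or.inl (codim1 p hW hc)
  right
  have h1 := Submodule.finrank_quotient_add_finrank W
  have h3 : Module.finrank F (V ⧸ W) = 2 := by
    rw [card_pow (F := F) V, card_pow (F := F) W, show 9 = 3 ^ 2 by norm_num, ← pow_add] at hc
    have := Nat.pow_right_injective (le_refl _ |>.trans (by norm_num : 2 ≤ 3)) hc
    omega
  let b := Module.finBasisOfFinrankEq F (V ⧸ W) h3
  refine ⟨fun z => b.repr (W.mkQ (z - p)) 0, fun z => b.repr (W.mkQ (z - p)) 1, ⟨⟨(b.coord 0).comp W.mkQ, - b.repr (W.mkQ p) 0, fun z => by simp [sub_eq_add_neg]⟩, ⟨(b.coord 1).comp W.mkQ, - b.repr (W.mkQ p) 1, fun z => by simp [sub_eq_add_neg]⟩, ?_⟩, ?_⟩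
  · intro a c
    obtain ⟨z, hz⟩ := W.mkQ_surjective (a • b 0 + c • b 1)
    refine ⟨z + p, ?_⟩
    simp only [add_sub_cancel_right, hz]
    simp
  · intro z hz hz'
    rw [← Submodule.Quotient.mk_eq_zero, ← Submodule.mkQ_apply]
    apply b.repr.map_eq_zero_iff.1
    ext i
    fin_cases i
    · exact hz
    · exact hz'
end RMx

namespace RMx
variable {F : Type} [Field F] [Fintype F] [hF : Fact (Fintype.card F = 3)]
variable {V : Type} [AddCommGroup V] [Module F V] [Finite V]

lemma cn_split' (f : V → F) (P : V → Prop) (x : V → F) (c : F) :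
    cn f P = cn f (fun z => P z ∧ x z = c) + cn f (fun z => P z ∧ x z = c + 1)
      + cn f (fun z => P z ∧ x z = c - 1) := by
  rw [cn_split f P (fun z => x z - c)]
  congr 1
  · congr 1
    · exact cn_congr fun z _ => and_congr_right fun _ => sub_eq_zero
    · exact cn_congr fun z _ => and_congr_right fun _ => 
        ⟨fun h => by linear_combination h, fun h => by linear_combination h⟩
  · exact cn_congr fun z _ => and_congr_right fun _ =>
      ⟨fun h => by linear_combination h, fun h => by linear_combination h⟩

lemma cn_add (f : V → F) (x : V → F) (c : F) (a : F) :
    cn f (fun z => x z + c = a) = cn f (fun z => x z = a - c) :=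
  cn_congr fun z _ => by rw [eq_sub_iff_add_eq]

section
variable {x : V → F} (hx : Aff x) (hs : Function.Surjective x) {f : V → F} {t : ℕ}

lemma hE (hx : Aff x) (hs : Function.Surjective x) (h : D (2 * t + 1) f) (c : F) :
    cn f (fun z => x z = c) = 0 ∨ Nat.card V ≤ 3 * cn f (fun z => x z = c) * 3 ^ t := by
  have := hbE0 (hx.shift (-c)) (surj_shift hs _) (bd_all _) h
  simpa only [cn_shift, neg_neg] using this

lemma hO (hx : Aff x) (hs : Function.Surjective x) (h : D (2 * t + 2) f) (c : F) :
    cn f (fun z => x z = c) = 0 ∨ 2 * Nat.card V ≤ 3 * cn f (fun z => x z = c) * 3 ^ (t + 1) := by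
  have := hbO0 (hx.shift (-c)) (surj_shift hs _) (bd_all _) h
  simpa only [cn_shift, neg_neg] using this

lemma hE1 (hx : Aff x) (hs : Function.Surjective x) (h : D (2 * t + 2) f) (a c : F)
    (ha : cn f (fun z => x z = a) = 0) :
    cn f (fun z => x z = c) = 0 ∨ Nat.card V ≤ 3 * cn f (fun z => x z = c) * 3 ^ t := by
  have := hbE1 (hx.shift (-c)) (surj_shift hs _) (bd_all _) h (a - c) (by rw [cn_add, ← ha]; simp)
  simpa only [cn_shift, neg_neg] using this

lemma hO1 (hx : Aff x) (hs : Function.Surjective x) (h : D (2 * t + 3) f) (a c : F)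
    (ha : cn f (fun z => x z = a) = 0) :
    cn f (fun z => x z = c) = 0 ∨ 2 * Nat.card V ≤ 3 * cn f (fun z => x z = c) * 3 ^ (t + 1) := by
  have := hbO1 (hx.shift (-c)) (surj_shift hs _) (bd_all _) h (a - c) (by rw [cn_add, ← ha]; simp)
  simpa only [cn_shift, neg_neg] using this
end

lemma Aff.restr {y : V → F} (hy : Aff y) (W : Submodule F V) (p : V) :
    Aff (fun w : W => y (p + w)) := by
  obtain ⟨l, c, hl⟩ := hy
  exact ⟨l.comp W.subtype, l p + c, fun w => by simp [hl]; ring⟩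

/-- the space `{x = a}` -/
lemma slice {x : V → F} (hx : Aff x) (hs : Function.Surjective x) (a : F) :
    ∃ (W : Submodule F V) (p : V), HD (fun z => x z + -a) W p ∧
      (∀ w : W, x (p + w) = a) ∧ (∀ z, x z = a → ∃ w : W, p + w = z) ∧
      (∀ f : V → F, Wt (fun w : W => f (p + w)) = cn f (fun z => x z = a)) ∧
      (∀ (f : V → F) (Q : V → Prop), cn (fun w : W => f (p + w)) (fun w => Q (p + w)) =
        cn f (fun z => x z = a ∧ Q z)) ∧
      (∀ y, PI x y → Function.Surjective (fun w : W => y (p + w))) ∧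
      (∀ y' : W → F, Aff y' → Function.Surjective y' → ∃ y : V → F, PI x y ∧
        ∀ w : W, y (p + w) = y' w) := by
  obtain ⟨W, p, hd, he⟩ := hd_exists (hx.shift (-a)) (surj_shift hs _)
  have e : ∀ z, x z + -a = 0 ↔ x z = a := fun z => by rw [add_neg_eq_zero]
  refine ⟨W, p, hd, fun w => (e _).1 (hd.zero w), ?_, ?_, ?_, ?_, ?_⟩
  · intro z hz
    exact ⟨⟨z - p, (hd.mem z).1 ((e z).2 hz)⟩, by simp⟩
  · intro f; rw [hd.wt]; simp only [e]
  · intro f Q; rw [hd.cn]; simp only [e]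
  · intro y hy c
    obtain ⟨z, h1, h2⟩ := hy.2.2 a c
    exact ⟨⟨z - p, (hd.mem z).1 ((e z).2 h1)⟩, by simpa using h2⟩
  · intro y' h1 h2
    obtain ⟨y, -, h4, h5⟩ := he y' h1
    refine ⟨y, ?_, h5⟩
    have := (h4 h2).shl a
    simpa using this

lemma q2E {x y : V → F} (h : PI x y) {f : V → F} {t : ℕ} (hf : D (2 * t + 3) f) (a b c : F)
    (h0 : cn f (fun z => x z = a ∧ y z = b) = 0) :
    cn f (fun z => x z = a ∧ y z = c) = 0 ∨
      2 * Nat.card V ≤ 9 * cn f (fun z => x z = a ∧ y z = c) * 3 ^ (t + 1) := by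
  obtain ⟨W, p, hd, -, -, -, hc, hsu, -⟩ := slice h.1 h.s1 a
  have hc' := fun b => hc f (fun z => y z = b)
  rw [← hc'] at h0 ⊢
  have := hO1 (h.2.1.restr W p) (hsu y h) (D_restr hf W p) b c h0
  rw [← hd.card]
  refine this.imp_right fun h => ?_
  linarith

lemma q2O {x y : V → F} (h : PI x y) {f : V → F} {t : ℕ} (hf : D (2 * t + 2) f) (a b c : F)
    (h0 : cn f (fun z => x z = a ∧ y z = b) = 0) :
    cn f (fun z => x z = a ∧ y z = c) = 0 ∨
      Nat.card V ≤ 9 * cn f (fun z => x z = a ∧ y z = c) * 3 ^ t := by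
  obtain ⟨W, p, hd, -, -, -, hc, hsu, -⟩ := slice h.1 h.s1 a
  have hc' := fun b => hc f (fun z => y z = b)
  rw [← hc'] at h0 ⊢
  have := hE1 (h.2.1.restr W p) (hsu y h) (D_restr hf W p) b c h0
  rw [← hd.card]
  refine this.imp_right fun h => ?_
  linarith

/-- lines -/
lemma line_cn {x y : V → F} {f : V → F} (h0 : cn f (fun z => x z = 0) = 0) (a b k : F) :
    cn f (fun z => y z + (a - b) * x z + (a + b) = k) =
      cn f (fun z => x z = 1 ∧ y z = a + k) + cn f (fun z => x z = -1 ∧ y z = b + k) := by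
  have h3 : (3 : F) = 0 := three_zero
  rw [cn_split f _ x]
  have e0 : cn f (fun z => y z + (a - b) * x z + (a + b) = k ∧ x z = 0) = 0 :=
    cn_zero.2 fun z hz => cn_zero.1 h0 z hz.2
  rw [e0, zero_add]
  congr 1
  · refine cn_congr fun z _ => ?_
    constructor
    · rintro ⟨h, h'⟩; refine ⟨h', ?_⟩; rw [h'] at h; linear_combination h - a * h3
    · rintro ⟨h', h⟩; refine ⟨?_, h'⟩; rw [h']; linear_combination h + a * h3
  · refine cn_congr fun z _ => ?_
    constructor
    · rintro ⟨h, h'⟩; refine ⟨h', ?_⟩; rw [h'] at h; linear_combination h - b * h3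
    · rintro ⟨h', h⟩; refine ⟨?_, h'⟩; rw [h']; linear_combination h + b * h3

lemma PI.line {x y : V → F} (h : PI x y) (a b : F) :
    PI x (fun z => y z + (a - b) * x z + (a + b)) := h.mod _ _

def Contained {F : Type} [Field F] {V : Type} [AddCommGroup V] [Module F V] (f : V → F) : Prop :=
  ∃ x : V → F, Aff x ∧ Function.Surjective x ∧ ∀ z, x z ≠ 0 → f z = 0
def Missing {F : Type} [Field F] {V : Type} [AddCommGroup V] [Module F V] (f : V → F) : Prop :=
  ∃ x : V → F, Aff x ∧ Function.Surjective x ∧ cn f (fun z => x z = 0) = 0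

lemma twocol {f x y : V → F} (h : PI x y) (h0 : cn f (fun z => x z = 0) = 0)
    (hP : ∀ z, x z = 1 → y z ≠ 0 → f z = 0) (B B' C : ℕ)
    (hb : ∀ l : V → F, Aff l → Function.Surjective l → ∀ c,
      cn f (fun z => l z = c) = 0 ∨ B ≤ C * cn f (fun z => l z = c))
    (hb' : ∀ l : V → F, Aff l → Function.Surjective l → ∀ a c, cn f (fun z => l z = a) = 0 →
      cn f (fun z => l z = c) = 0 ∨ B' ≤ C * cn f (fun z => l z = c))
    (h1 : C * cn f (fun z => x z = -1) < 3 * B) (h2 : C * cn f (fun z => x z = -1) < 2 * B') :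
    Contained f := by
  have h3 : (3 : F) = 0 := three_zero
  have hP1 : ∀ a : F, a ≠ 0 → cn f (fun z => x z = 1 ∧ y z = a) = 0 := fun a ha =>
    cn_zero.2 fun z hz => hP z hz.1 (by rw [hz.2]; exact ha)
  have hm1 : (-1 : F) ≠ 0 := neg_ne_zero.2 one_ne_zero
  have e1 : (1 : F) + 1 = -1 := by linear_combination h3
  have e2 : (-1 : F) + -1 = 1 := by linear_combination -h3
  have Q1 : ∀ b : F, cn f (fun z => x z = -1 ∧ y z = b) = 0 ∨
      B ≤ C * cn f (fun z => x z = -1 ∧ y z = b) := by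
    intro b
    have := hb _ (h.line 1 b).2.1 (h.line 1 b).swap.s1 0
    simpa only [line_cn h0, add_zero, hP1 1 one_ne_zero, zero_add] using this
  have Q2 : ∀ b c : F, cn f (fun z => x z = -1 ∧ y z = b) = 0 → b ≠ c →
      cn f (fun z => x z = -1 ∧ y z = c) = 0 ∨
      B' ≤ C * cn f (fun z => x z = -1 ∧ y z = c) := by
    intro b c hb0 hbc
    have key : c = b + 1 ∨ c = b + -1 := by
      rcases tri (c - b) with h | h | h
      · exact absurd (by linear_combination -h) hbc
      · left; linear_combination h
      · right; linear_combination h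
    rcases key with rfl | rfl
    · have := hb' _ (h.line 1 b).2.1 (h.line 1 b).swap.s1 0 1
      simp only [line_cn h0, add_zero, hP1 1 one_ne_zero, zero_add, e1, hP1 _ hm1] at this
      exact this hb0
    · have := hb' _ (h.line (-1) b).2.1 (h.line (-1) b).swap.s1 0 (-1)
      simp only [line_cn h0, add_zero, hP1 1 one_ne_zero, zero_add, e2, hP1 _ hm1] at this
      exact this hb0
  have fin : ∀ b : F, (∀ c, c ≠ b → cn f (fun z => x z = -1 ∧ y z = c) = 0) → Contained f := by
    intro b hb
    refine ⟨_, (h.line 0 b).2.1, (h.line 0 b).swap.s1, fun z hz => ?_⟩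
    by_contra hfz
    apply hz
    rcases tri (x z) with hx | hx | hx
    · exact absurd (cn_zero.1 h0 z hx) hfz
    · have : y z = 0 := by
        by_contra hy
        exact hfz (hP z hx hy)
      rw [hx, this]; ring
    · have : y z = b := by
        by_contra hy
        exact hfz (cn_zero.1 (hb _ hy) z ⟨hx, rfl⟩)
      rw [hx, this]; linear_combination b * h3
  rcases three_pat (fun c : F => cn f (fun z => x z = -1 ∧ y z = c) = 0) with g | ⟨a, g1, g2⟩ | ⟨a, g1, g2⟩ | g
  · exfalso
    rw [cn_split' f _ y 0] at h1
    have r := fun b => (Q1 b).resolve_left (g b)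
    have a0 := r 0; have a1 := r (0 + 1); have a2 := r (0 - 1)
    nlinarith
  · exfalso
    rw [cn_split' f _ y a] at h2
    have n1 : a + 1 ≠ a := by simp
    have n2 : a - 1 ≠ a := by simp
    have a1 := (Q2 a (a + 1) g1 n1.symm).resolve_left (g2 _ n1)
    have a2 := (Q2 a (a - 1) g1 n2.symm).resolve_left (g2 _ n2)
    nlinarith
  · exact fin a g2
  · exact fin 0 fun c _ => g c

lemma Wt_le_card (f : V → F) (h : ∀ z, f z ≠ 0) : Wt f = Nat.card V := by
  unfold Wt
  rw [← Set.ncard_univ]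
  congr 1
  ext z; simp [h]

lemma ex_zero {f : V → F} (h : Wt f < Nat.card V) : ∃ z, f z = 0 := by
  by_contra hc
  push Not at hc
  exact absurd (Wt_le_card f hc) h.ne

lemma ne_top_of {f : V → F} (hf : Wt f ≠ 0) {W : Submodule F V} {p : V}
    (h : cn f (fun z => z - p ∈ W) = 0) : W ≠ ⊤ := by
  rintro rfl
  apply hf
  rw [Wt_zero]
  intro z
  exact cn_zero.1 h z trivial

lemma EC {f : V → F} {t : ℕ} (hf : D (2 * t + 3) f) (h0 : Wt f ≠ 0)
    (hw : Wt f * 3 ^ (t + 2) < 4 * Nat.card V) : Contained f := by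
  have hp : 1 ≤ 3 ^ t := Nat.one_le_pow _ _ (by norm_num)
  have hp2 : 3 ^ (t + 2) = 9 * 3 ^ t := by ring
  have hz : ∃ z, f z = 0 := ex_zero (by rw [hp2] at hw; nlinarith)
  obtain ⟨W, p, hW, hM⟩ := lemM f (3 ^ (t + 1)) 1 (by positivity) hz (HE (t := t + 1) hf)
  obtain ⟨x, hx, hs, hxz⟩ := codim1 p (ne_top_of h0 hW) (by
    have : 3 ^ (t + 2) = 3 * 3 ^ (t + 1) := by ring
    rw [this] at hw
    nlinarith)
  have hm : cn f (fun z => x z = 0) = 0 := cn_zero.2 fun z hz => cn_zero.1 hW z (hxz z hz)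
  have b1 := hO1 hx hs hf 0 1 hm
  have b2 := hO1 hx hs hf 0 (-1) hm
  have sp := Wt_split f x
  rw [hm] at sp
  by_cases c1 : cn f (fun z => x z = 1) = 0
  · refine ⟨fun z => x z + 1, hx.shift 1, surj_shift hs _, fun z hz => ?_⟩
    rcases tri (x z) with h | h | h
    · exact cn_zero.1 hm z h
    · exact cn_zero.1 c1 z h
    · exact absurd (by simp [h]) hz
  by_cases c2 : cn f (fun z => x z = -1) = 0
  · refine ⟨fun z => x z + -1, hx.shift _, surj_shift hs _, fun z hz => ?_⟩
    rcases tri (x z) with h | h | h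
    · exact cn_zero.1 hm z h
    · exact absurd (by simp [h]) hz
    · exact cn_zero.1 c2 z h
  exfalso
  have b1 := b1.resolve_left c1
  have b2 := b2.resolve_left c2
  rw [sp] at hw
  have : 3 ^ (t + 2) = 3 * 3 ^ (t + 1) := by ring
  rw [this] at hw
  nlinarith

lemma OM {f : V → F} {t : ℕ} (hf : D (2 * t + 2) f) (h0 : Wt f ≠ 0)
    (hw : Wt f * 3 ^ (t + 1) = 2 * Nat.card V) : Missing f := by
  have hp : 1 ≤ 3 ^ t := Nat.one_le_pow _ _ (by norm_num)
  have hp2 : 3 ^ (t + 1) = 3 * 3 ^ t := by ring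
  have hpos : 0 < Nat.card V := Nat.card_pos
  have hz : ∃ z, f z = 0 := ex_zero (by rw [hp2] at hw; nlinarith)
  obtain ⟨W, p, hW, hM⟩ := lemM f (3 ^ (t + 1)) 2 (by positivity) hz (HO hf)
  obtain ⟨x, hx, hs, hxz⟩ := codim1 p (ne_top_of h0 hW) (by nlinarith)
  exact ⟨x, hx, hs, cn_zero.2 fun z hz => cn_zero.1 hW z (hxz z hz)⟩

lemma contained_of_two {f x : V → F} (hx : Aff x) (hs : Function.Surjective x)
    (hm : cn f (fun z => x z = 0) = 0) (h : cn f (fun z => x z = 1) = 0 ∨ cn f (fun z => x z = -1) = 0) :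
    Contained f := by
  rcases h with c1 | c2
  · refine ⟨fun z => x z + 1, hx.shift 1, surj_shift hs _, fun z hz => ?_⟩
    rcases tri (x z) with h | h | h
    · exact cn_zero.1 hm z h
    · exact cn_zero.1 c1 z h
    · exact absurd (by simp [h]) hz
  · refine ⟨fun z => x z + -1, hx.shift _, surj_shift hs _, fun z hz => ?_⟩
    rcases tri (x z) with h | h | h
    · exact cn_zero.1 hm z h
    · exact absurd (by simp [h]) hz
    · exact cn_zero.1 c2 z h

/-- lift a containing hyperplane of a slice -/
lemma lift_cont {x : V → F} (hx : Aff x) (hs : Function.Surjective x) (a : F) (f : V → F)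
    (W : Submodule F V) (p : V) (h2 : ∀ z, x z = a → ∃ w : W, p + w = z)
    (h3 : (∀ y' : W → F, Aff y' → Function.Surjective y' → ∃ y : V → F, PI x y ∧
        ∀ w : W, y (p + w) = y' w))
    (hc : Contained (fun w : W => f (p + w))) :
    ∃ y, PI x y ∧ ∀ z, x z = a → y z ≠ 0 → f z = 0 := by
  obtain ⟨y', g1, g2, g3⟩ := hc
  obtain ⟨y, hy, hyw⟩ := h3 y' g1 g2
  refine ⟨y, hy, fun z hz hyz => ?_⟩
  obtain ⟨w, rfl⟩ := h2 z hz
  exact g3 w (by rwa [← hyw])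

lemma lift_miss {x : V → F} (hx : Aff x) (hs : Function.Surjective x) (a : F) (f : V → F)
    (W : Submodule F V) (p : V) (h2 : ∀ z, x z = a → ∃ w : W, p + w = z)
    (h3 : (∀ y' : W → F, Aff y' → Function.Surjective y' → ∃ y : V → F, PI x y ∧
        ∀ w : W, y (p + w) = y' w))
    (hc : Missing (fun w : W => f (p + w))) :
    ∃ y, PI x y ∧ cn f (fun z => x z = a ∧ y z = 0) = 0 := by
  obtain ⟨y', g1, g2, g3⟩ := hc
  obtain ⟨y, hy, hyw⟩ := h3 y' g1 g2
  refine ⟨y, hy, cn_zero.2 ?_⟩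
  rintro z ⟨hz, hyz⟩
  obtain ⟨w, rfl⟩ := h2 z hz
  exact cn_zero.1 g3 w (by rwa [← hyw])

lemma OC {f : V → F} {t : ℕ} (hf : D (2 * t + 4) f) (h0 : Wt f ≠ 0)
    (hw : Wt f * 3 ^ (t + 2) = 2 * Nat.card V) : Contained f := by
  obtain ⟨x, hx, hs, hm⟩ := OM (t := t + 1) hf h0 hw
  by_contra hnc
  have c1 : cn f (fun z => x z = 1) ≠ 0 := fun h => hnc (contained_of_two hx hs hm (Or.inl h))
  have c2 : cn f (fun z => x z = -1) ≠ 0 := fun h => hnc (contained_of_two hx hs hm (Or.inr h))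
  have b1 := (hE1 (t := t + 1) hx hs hf 0 1 hm).resolve_left c1
  have b2 := (hE1 (t := t + 1) hx hs hf 0 (-1) hm).resolve_left c2
  have sp := Wt_split f x
  have T : 3 ^ (t + 2) = 3 * 3 ^ (t + 1) := by ring
  have hpos : 0 < Nat.card V := Nat.card_pos
  rw [hm, zero_add] at sp
  rw [sp, T] at hw
  have e1 : cn f (fun z => x z = 1) * 3 ^ (t + 2) = Nat.card V := by rw [T]; nlinarith
  have e2 : cn f (fun z => x z = -1) * 3 ^ (t + 2) = Nat.card V := by rw [T]; nlinarith
  obtain ⟨W, p, hd, -, g2, gw, -, -, g3⟩ := slice hx hs 1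
  have hcont : Contained (fun w : W => f (p + w)) := by
    apply EC (t := t)
    · exact hd.drop1 hf (surj_shift hs _) (-1) (fun z hz => cn_zero.1 hm z (by linear_combination hz))
    · rw [gw]; exact c1
    · rw [gw, e1, ← hd.card]
      have : 0 < Nat.card W := Nat.card_pos
      omega
  obtain ⟨y, hy, hyz⟩ := lift_cont hx hs 1 f W p g2 g3 hcont
  apply hnc
  have bb : ∀ l : V → F, Aff l → Function.Surjective l → ∀ c,
      cn f (fun z => l z = c) = 0 ∨ 2 * Nat.card V ≤ (3 * 3 ^ (t + 2)) * cn f (fun z => l z = c) := by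
    intro l hl hls c
    refine (hO (t := t + 1) hl hls hf c).imp_right fun h => ?_
    rw [show t + 1 + 1 = t + 2 by rfl] at h
    linarith
  refine twocol hy hm hyz (2 * Nat.card V) (2 * Nat.card V) (3 * 3 ^ (t + 2)) bb
    (fun l hl hls _ c _ => bb l hl hls c) ?_ ?_
  · nlinarith
  · nlinarith

lemma cn_le {f : V → F} {P Q : V → Prop} (h : ∀ z, P z → Q z) : cn f P ≤ cn f Q :=
  Set.ncard_le_ncard (fun _ hz => ⟨hz.1, h _ hz.2⟩) (Set.toFinite _)

end RMx

namespace RMx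
variable {F : Type} [Field F] [Fintype F] [hF : Fact (Fintype.card F = 3)]
variable {V : Type} [AddCommGroup V] [Module F V] [Finite V]

noncomputable def nn {F : Type} [Field F] {V : Type} (f x y : V → F) (a b : F) : ℕ := cn f (fun z => x z = a ∧ y z = b)

lemma nn_swap (f x y : V → F) (a b : F) : nn f x y a b = nn f y x b a :=
  cn_congr fun _ _ => and_comm

lemma nn_col (f x y : V → F) (a : F) :
    cn f (fun z => x z = a) = nn f x y a 0 + nn f x y a 1 + nn f x y a (-1) := by
  rw [cn_split' f _ y 0]
  simp only [zero_add, zero_sub]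
  rfl

lemma nn_row (f x y : V → F) (b : F) :
    cn f (fun z => y z = b) = nn f x y 0 b + nn f x y 1 b + nn f x y (-1) b := by
  rw [nn_col f y x, nn_swap f y x, nn_swap f y x, nn_swap f y x]

lemma nn_line (f x y : V → F) (s k : F) :
    cn f (fun z => y z + s * x z + -k = 0) = nn f x y 0 k + nn f x y 1 (k - s) + nn f x y (-1) (k + s) := by
  rw [cn_split' f _ x 0]
  simp only [zero_add, zero_sub, nn]
  congr 1
  · congr 1
    · refine cn_congr fun z _ => ?_
      constructor
      · rintro ⟨h, h'⟩; refine ⟨h', ?_⟩; rw [h'] at h; linear_combination h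
      · rintro ⟨h', h⟩; refine ⟨?_, h'⟩; rw [h']; linear_combination h
    · refine cn_congr fun z _ => ?_
      constructor
      · rintro ⟨h, h'⟩; refine ⟨h', ?_⟩; rw [h'] at h; linear_combination h
      · rintro ⟨h', h⟩; refine ⟨?_, h'⟩; rw [h']; linear_combination h
  · refine cn_congr fun z _ => ?_
    constructor
    · rintro ⟨h, h'⟩; refine ⟨h', ?_⟩; rw [h'] at h; linear_combination h
    · rintro ⟨h', h⟩; refine ⟨?_, h'⟩; rw [h']; linear_combination h

lemma f11 : (1 : F) + 1 = -1 := by linear_combination three_zero (F := F)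
lemma f22 : (-1 : F) + -1 = 1 := by linear_combination - three_zero (F := F)

/-- every hyperplane property gives 12 statements -/
lemma grid {f x y : V → F} (h : PI x y) (B : ℕ)
    (H : ∀ l : V → F, Aff l → Function.Surjective l → B ≤ cn f (fun z => l z = 0)) :
    (∀ a, B ≤ cn f (fun z => x z = a)) ∧ (∀ a, B ≤ cn f (fun z => y z = a)) ∧
    B ≤ nn f x y 0 0 + nn f x y 1 1 + nn f x y (-1) (-1) ∧
    B ≤ nn f x y 0 1 + nn f x y 1 (-1) + nn f x y (-1) 0 ∧
    B ≤ nn f x y 0 (-1) + nn f x y 1 0 + nn f x y (-1) 1 ∧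
    B ≤ nn f x y 0 0 + nn f x y 1 (-1) + nn f x y (-1) 1 ∧
    B ≤ nn f x y 0 1 + nn f x y 1 0 + nn f x y (-1) (-1) ∧
    B ≤ nn f x y 0 (-1) + nn f x y 1 1 + nn f x y (-1) 0 := by
  have L : ∀ s k, B ≤ nn f x y 0 k + nn f x y 1 (k - s) + nn f x y (-1) (k + s) := by
    intro s k
    rw [← nn_line]
    have := h.mod s (-k)
    exact H _ this.2.1 this.swap.s1
  have e : (-1 : F) - 1 = 1 := by linear_combination - three_zero (F := F)
  have e' : (1 : F) - -1 = -1 := by linear_combination three_zero (F := F)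
  have K : ∀ x : V → F, Aff x → Function.Surjective x → ∀ a, B ≤ cn f (fun z => x z = a) := by
    intro x hx hs a
    have := H _ (hx.shift (-a)) (surj_shift hs _)
    rwa [cn_shift, neg_neg] at this
  refine ⟨K x h.1 h.s1, K y h.2.1 h.swap.s1, ?_, ?_, ?_, ?_, ?_, ?_⟩
  · simpa using L (-1) 0
  · simpa [e'] using L (-1) 1
  · simpa [f22] using L (-1) (-1)
  · simpa using L 1 0
  · simpa [f11] using L 1 1
  · simpa [e] using L 1 (-1)

lemma cn00 {f x y : V → F} {p : V} {W : Submodule F V} (hW : cn f (fun z => z - p ∈ W) = 0)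
    (h : ∀ z, x z = 0 → y z = 0 → z - p ∈ W) : nn f x y 0 0 = 0 :=
  cn_zero.2 fun z hz => cn_zero.1 hW z (h z hz.1 hz.2)

lemma E4 {f : V → F} {t N : ℕ} (hf : D (2 * t + 3) f) (hN : 0 < N) (hw : Wt f = 4 * N)
    (hc : Nat.card V = 3 * N * 3 ^ (t + 1)) : Missing f := by
  by_contra hM
  have hT : 3 ^ (t + 1) = 3 * 3 ^ t := by ring
  have hp : 1 ≤ 3 ^ t := Nat.one_le_pow _ _ (by norm_num)
  have hT0 : 0 < 3 ^ (t + 1) := by positivity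
  have hz : ∃ z, f z = 0 := ex_zero (by rw [hw, hc, hT]; nlinarith)
  obtain ⟨W, p, hW, hMW⟩ := lemM f (3 ^ (t + 1)) 1 (by positivity) hz (HE (t := t + 1) hf)
  rcases codim2 p (ne_top_of (by omega) hW) (by rw [hw, hc] at hMW; rw [hc]; nlinarith) with ⟨x, hx, hs, h⟩ | ⟨x, y, hxy, h⟩
  · exact hM ⟨x, hx, hs, cn_zero.2 fun z hz => cn_zero.1 hW z (h z hz)⟩
  have h00 := cn00 hW h
  have H : ∀ l : V → F, Aff l → Function.Surjective l → N ≤ cn f (fun z => l z = 0) := by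
    intro l hl hls
    have := (hE (t := t + 1) hl hls hf 0).resolve_left fun h => hM ⟨l, hl, hls, h⟩
    rw [hc] at this
    have h2 : N * (3 * 3 ^ (t+1)) ≤ cn f (fun z => l z = 0) * (3 * 3 ^ (t+1)) := by linarith
    exact Nat.le_of_mul_le_mul_right h2 (by positivity)
  obtain ⟨gx, gy, g1, g2, g3, g4, g5, g6⟩ := grid hxy N H
  have Q : ∀ x y : V → F, PI x y → nn f x y 0 0 = 0 → ∀ c, nn f x y 0 c = 0 ∨ 2 * N ≤ 3 * nn f x y 0 c := by
    intro x y hxy h0 c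
    refine (q2E hxy hf 0 0 c h0).imp_right fun h => ?_
    rw [hc] at h
    have h2 : (2 * N) * (3 * 3 ^ (t+1)) ≤ (3 * nn f x y 0 c) * (3 * 3 ^ (t+1)) := by
      have : nn f x y 0 c = cn f (fun z => x z = 0 ∧ y z = c) := rfl
      rw [this]; linarith
    exact Nat.le_of_mul_le_mul_right h2 (by positivity)
  -- diagonal lines
  have D1 : ∀ s : F, s ≠ 0 → ∀ c, nn f x y c (-s * c) = 0 ∨ 2 * N ≤ 3 * nn f x y c (-s * c) := by
    intro s hs c
    have e : ∀ c, nn f (fun z => y z + s * x z + 0) x 0 c = nn f x y c (-s * c) := by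
      intro c
      refine cn_congr fun z _ => ?_
      constructor
      · rintro ⟨h, h'⟩; refine ⟨h', ?_⟩; beta_reduce at h; rw [h'] at h; linear_combination h
      · rintro ⟨h', h⟩; refine ⟨?_, h'⟩; beta_reduce; rw [h']; linear_combination h
    have := Q _ x (hxy.mod s 0).swap (by rw [e]; simpa using h00) c
    rwa [e] at this
  have q1 := Q x y hxy h00 1
  have q2 := Q x y hxy h00 (-1)
  have q3 := Q y x hxy.swap (by rw [nn_swap]; exact h00) 1
  have q4 := Q y x hxy.swap (by rw [nn_swap]; exact h00) (-1)
  rw [nn_swap] at q3 q4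
  have q5 := D1 1 one_ne_zero 1
  have q6 := D1 1 one_ne_zero (-1)
  have q7 := D1 (-1) (by simp) 1
  have q8 := D1 (-1) (by simp) (-1)
  simp only [mul_one, neg_neg, mul_neg] at q5 q6 q7 q8
  have x0 := gx 0; have x1 := gx 1; have x2 := gx (-1)
  have y0 := gy 0; have y1 := gy 1; have y2 := gy (-1)
  have sp := Wt_split f x
  rw [nn_col f x y] at x0 x1 x2
  rw [nn_row f x y] at y0 y1 y2
  rw [nn_col f x y 0, nn_col f x y 1, nn_col f x y (-1), hw] at sp
  have s1 : nn f x y 0 1 = 0 ∨ nn f x y 0 (-1) = 0 := by omega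
  have s2 : nn f x y 1 0 = 0 ∨ nn f x y (-1) 0 = 0 := by omega
  have s3 : nn f x y 1 (-1) = 0 ∨ nn f x y (-1) 1 = 0 := by omega
  have s4 : nn f x y 1 1 = 0 ∨ nn f x y (-1) (-1) = 0 := by omega
  clear q1 q2 q3 q4 q5 q6 q7 q8
  rcases s1 with s1 | s1 <;> rcases s2 with s2 | s2 <;> rcases s3 with s3 | s3 <;> rcases s4 with s4 | s4 <;> omega

section main
variable {f : V → F} {t N : ℕ}

lemma mO {x : V → F} (hf : D (2 * t + 2) f) (hc : Nat.card V = 9 * N * 3 ^ t) (hx : Aff x)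
    (hs : Function.Surjective x) (c : F) :
    cn f (fun z => x z = c) = 0 ∨ 2 * N ≤ cn f (fun z => x z = c) := by
  refine (hO hx hs hf c).imp_right fun h => ?_
  rw [hc, pow_succ] at h
  have h2 : (2 * N) * (9 * 3 ^ t) ≤ cn f (fun z => x z = c) * (9 * 3 ^ t) := by linarith
  exact Nat.le_of_mul_le_mul_right h2 (by positivity)

lemma mE1 {x : V → F} (hf : D (2 * t + 2) f) (hc : Nat.card V = 9 * N * 3 ^ t) (hx : Aff x)
    (hs : Function.Surjective x) (a c : F) (ha : cn f (fun z => x z = a) = 0) :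
    cn f (fun z => x z = c) = 0 ∨ 3 * N ≤ cn f (fun z => x z = c) := by
  refine (hE1 hx hs hf a c ha).imp_right fun h => ?_
  rw [hc] at h
  have h2 : (3 * N) * (3 * 3 ^ t) ≤ cn f (fun z => x z = c) * (3 * 3 ^ t) := by linarith
  exact Nat.le_of_mul_le_mul_right h2 (by positivity)

lemma mq {x y : V → F} (hf : D (2 * t + 2) f) (hc : Nat.card V = 9 * N * 3 ^ t) (h : PI x y)
    (a b c : F) (h0 : nn f x y a b = 0) : nn f x y a c = 0 ∨ N ≤ nn f x y a c := by
  refine (q2O h hf a b c h0).imp_right fun h => ?_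
  rw [hc] at h
  have e : nn f x y a c = cn f (fun z => x z = a ∧ y z = c) := rfl
  rw [e]
  have h2 : N * (9 * 3 ^ t) ≤ cn f (fun z => x z = a ∧ y z = c) * (9 * 3 ^ t) := by linarith
  exact Nat.le_of_mul_le_mul_right h2 (by positivity)

lemma B1 (hf : D (2 * (t + 1) + 2) f) (hN : 0 < N) (hw : Wt f = 8 * N)
    (hc : Nat.card V = 9 * N * 3 ^ (t + 1)) (hM : ¬ Missing f) {x : V → F} (hx : Aff x)
    (hs : Function.Surjective x) (h2 : cn f (fun z => x z = 0) = 2 * N) :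
    cn f (fun z => x z = 1) = 3 * N ∧ cn f (fun z => x z = -1) = 3 * N ∧
    ∃ y : V → F, Aff y ∧ Function.Surjective y ∧ cn f (fun z => y z = 1) = 2 * N ∧
      cn f (fun z => y z = 0) = 4 * N := by
  obtain ⟨W, p, hd, -, g2, gw, -, -, g3⟩ := slice hx hs 0
  have hcont : Contained (fun w : W => f (p + w)) := by
    apply OC (t := t) (D_restr hf W p)
    · rw [gw]; omega
    · rw [gw, h2]
      have := hd.card
      rw [hc] at this
      have e : 3 ^ (t + 2) = 3 * 3 ^ (t + 1) := by ring
      rw [e]; linarith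
  obtain ⟨y, hy, hyz⟩ := lift_cont hx hs 0 f W p g2 g3 hcont
  have hn : ∀ b : F, b ≠ 0 → nn f x y 0 b = 0 := fun b hb =>
    cn_zero.2 fun z hz => hyz z hz.1 (by rw [hz.2]; exact hb)
  have n1 := hn 1 one_ne_zero
  have n2 := hn (-1) (by simp)
  have H : ∀ l : V → F, Aff l → Function.Surjective l → 2 * N ≤ cn f (fun z => l z = 0) := by
    intro l hl hls
    exact (mO hf hc hl hls 0).resolve_left fun h => hM ⟨l, hl, hls, h⟩
  obtain ⟨gx, gy, g1, g2, g3, g4, g5, g6⟩ := grid hy (2 * N) H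
  have q1 := mq hf hc hy.swap 1 0 1 (by rw [nn_swap]; exact n1)
  have q2 := mq hf hc hy.swap 1 0 (-1) (by rw [nn_swap]; exact n1)
  rw [nn_swap] at q1 q2
  have x0 := gx 0; have x1 := gx 1; have x2 := gx (-1)
  have y0 := gy 0; have y1 := gy 1; have y2 := gy (-1)
  have sp := Wt_split f x
  refine ⟨?_, ?_, y, hy.2.1, hy.swap.s1, ?_, ?_⟩ <;>
  simp only [nn_row f x y, nn_col f x y] at * <;> omega

lemma caseB (hf : D (2 * (t + 1) + 2) f) (hN : 0 < N) (hw : Wt f = 8 * N)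
    (hc : Nat.card V = 9 * N * 3 ^ (t + 1)) : Missing f := by
  by_contra hM
  have hT : 3 ^ (t + 1) = 3 * 3 ^ t := by ring
  have hp : 1 ≤ 3 ^ t := Nat.one_le_pow _ _ (by norm_num)
  have hz : ∃ z, f z = 0 := ex_zero (by rw [hw, hc, hT]; nlinarith)
  obtain ⟨W, p, hW, hMW⟩ := lemM f (3 ^ (t + 1 + 1)) 2 (by positivity) hz (HO hf)
  rcases codim2 p (ne_top_of (by omega) hW) (by
    rw [hw, hc] at hMW; rw [hc]
    have hT : 3 ^ (t + 1 + 1) = 3 * 3 ^ (t + 1) := by ring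
    rw [hT] at hMW
    nlinarith) with ⟨x, hx, hs, h⟩ | ⟨x, y, hxy, h⟩
  · exact hM ⟨x, hx, hs, cn_zero.2 fun z hz => cn_zero.1 hW z (h z hz)⟩
  have h00 := cn00 hW h
  have H : ∀ l : V → F, Aff l → Function.Surjective l → 2 * N ≤ cn f (fun z => l z = 0) := by
    intro l hl hls
    exact (mO hf hc hl hls 0).resolve_left fun h => hM ⟨l, hl, hls, h⟩
  obtain ⟨gx, gy, g1, g2, g3, g4, g5, g6⟩ := grid hxy (2 * N) H
  have x0 := gx 0; have x1 := gx 1; have x2 := gx (-1)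
  have y0 := gy 0; have y1 := gy 1; have y2 := gy (-1)
  have sp := Wt_split f x
  have h2 : cn f (fun z => x z = 0) = 2 * N := by
    simp only [nn_row f x y, nn_col f x y] at *; omega
  obtain ⟨-, -, u, hu, hus, u1, u0⟩ := B1 hf hN hw hc hM hxy.1 hxy.s1 h2
  have := (B1 hf hN hw hc hM (hu.shift (-1)) (surj_shift hus _) (by simpa [cn_shift] using u1)).2.1
  rw [cn_add] at this
  simp only [sub_self] at this
  omega
end main
end RMx

namespace RMx
variable {F : Type} [Field F] [Fintype F] [hF : Fact (Fintype.card F = 3)]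
variable {V : Type} [AddCommGroup V] [Module F V] [Finite V]

lemma surj_neg {x : V → F} (hs : Function.Surjective x) : Function.Surjective (fun z => - x z) :=
  fun a => by obtain ⟨z, hz⟩ := hs (-a); exact ⟨z, by simp [hz]⟩

lemma cn_neg (f x : V → F) (a : F) : cn f (fun z => - x z = a) = cn f (fun z => x z = -a) :=
  cn_congr fun z _ => neg_eq_iff_eq_neg

lemma Wt_le (f : V → F) : Wt f ≤ Nat.card V := by
  unfold Wt
  rw [← Set.ncard_univ]
  exact Set.ncard_le_ncard (Set.subset_univ _) (Set.toFinite _)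

lemma nn_le {x y : V → F} (h : PI x y) (f : V → F) (a b : F) : 9 * nn f x y a b ≤ Nat.card V := by
  obtain ⟨W, p, hd, -, -, gw, gc, gs, -⟩ := slice h.1 h.s1 a
  obtain ⟨U, q, hd', -, -, gw', -⟩ := slice (h.2.1.restr W p) (gs y h) b
  have h1 := gc f (fun z => y z = b)
  have h2 := gw' (fun w : W => f (p + w))
  have h3 := Wt_le (fun u : U => f (p + ((q + u : W) : V)))
  have h4 := hd.card
  have h5 := hd'.card
  unfold nn
  rw [← h1]
  omega

def TS {F : Type} [Field F] {V : Type} [AddCommGroup V] [Module F V] (x y z : V → F) : Prop :=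
  Aff x ∧ Aff y ∧ Aff z ∧ ∀ a b c, ∃ s, x s = a ∧ y s = b ∧ z s = c

lemma nnn_le {x y z : V → F} (h : TS x y z) (f : V → F) (a b c : F) :
    27 * cn f (fun s => (x s = a ∧ y s = b) ∧ z s = c) ≤ Nat.card V := by
  have hxs : Function.Surjective x := fun a => by
    obtain ⟨s, h, -⟩ := h.2.2.2 a 0 0
    exact ⟨s, h⟩
  obtain ⟨W, p, hd, -, g2, gw, gc, gs, -⟩ := slice h.1 hxs a
  have hp : PI (fun w : W => y (p + w)) (fun w : W => z (p + w)) := by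
    refine ⟨h.2.1.restr W p, h.2.2.1.restr W p, fun b c => ?_⟩
    obtain ⟨s, h1, h2, h3⟩ := h.2.2.2 a b c
    obtain ⟨w, rfl⟩ := g2 s h1
    exact ⟨w, h2, h3⟩
  have h1 := nn_le hp (fun w : W => f (p + w)) b c
  have h2 := gc f (fun s => y s = b ∧ z s = c)
  have h4 := hd.card
  simp only [and_assoc]
  unfold nn at h1
  beta_reduce at h1 h2
  omega

section
variable {f : V → F} {t N : ℕ} {x : V → F}

structure AS {F : Type} [Field F] {V : Type} [AddCommGroup V] [Module F V] (f x : V → F) (t N : ℕ) : Prop where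
  hf : D (2 * (t + 1) + 2) f
  hN : 0 < N
  hw : Wt f = 8 * N
  hc : Nat.card V = 9 * N * 3 ^ (t + 1)
  hx : Aff x
  hs : Function.Surjective x
  hm : cn f (fun z => x z = 0) = 0
  hn : ¬ Contained f

lemma AS.neg (A : AS f x t N) : AS f (fun z => - x z) t N :=
  ⟨A.hf, A.hN, A.hw, A.hc, A.hx.neg, surj_neg A.hs, by rw [cn_neg, neg_zero, A.hm], A.hn⟩

lemma AS.a1 (A : AS f x t N) {y : V → F} (h : PI x y) (hy : ∀ z, x z = 1 → y z ≠ 0 → f z = 0) : False := by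
  have n1 : cn f (fun z => x z = 1) ≠ 0 := fun h => A.hn (contained_of_two A.hx A.hs A.hm (Or.inl h))
  have b1 := (mE1 A.hf A.hc A.hx A.hs 0 1 A.hm).resolve_left n1
  have sp := Wt_split f x
  have := A.hm
  have := A.hw
  have := A.hN
  refine A.hn (twocol h A.hm hy (2 * N) (3 * N) 1 ?_ ?_ (by omega) (by omega))
  · intro l hl hls c
    rw [one_mul]; exact mO A.hf A.hc hl hls c
  · intro l hl hls a c ha
    rw [one_mul]; exact mE1 A.hf A.hc hl hls a c ha

lemma AS.a1' (A : AS f x t N) {y : V → F} (h : PI x y) (hy : ∀ z, x z = -1 → y z ≠ 0 → f z = 0) : False :=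
  A.neg.a1 h.negl fun z hz => hy z (by rw [← hz]; simp)

/-- slice with everything -/
lemma AS.sl (A : AS f x t N) : ∃ (W : Submodule F V) (p : V), Nat.card W = 3 * N * 3 ^ (t + 1) ∧
      D (2 * t + 3) (fun w : W => f (p + w)) ∧
      (∀ w : W, x (p + w) = 1) ∧ (∀ z, x z = 1 → ∃ w : W, p + w = z) ∧
      (∀ f : V → F, Wt (fun w : W => f (p + w)) = cn f (fun z => x z = 1)) ∧
      (∀ (f : V → F) (Q : V → Prop), cn (fun w : W => f (p + w)) (fun w => Q (p + w)) =
        cn f (fun z => x z = 1 ∧ Q z)) ∧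
      (∀ y, PI x y → Function.Surjective (fun w : W => y (p + w))) ∧
      (∀ y' : W → F, Aff y' → Function.Surjective y' → ∃ y : V → F, PI x y ∧
        ∀ w : W, y (p + w) = y' w) ∧ ¬ Contained (fun w : W => f (p + w)) := by
  obtain ⟨W, p, hd, g1, g2, gw, gc, gs, g3⟩ := slice A.hx A.hs 1
  refine ⟨W, p, ?_, ?_, g1, g2, gw, gc, gs, g3, ?_⟩
  · have := hd.card; rw [A.hc] at this; linarith
  · exact hd.drop1 A.hf (surj_shift A.hs _) (-1) (fun z hz => cn_zero.1 A.hm z (by linear_combination hz))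
  · intro hcont
    obtain ⟨y, hy, hyz⟩ := lift_cont A.hx A.hs 1 f W p g2 g3 hcont
    exact A.a1 hy hyz

lemma AS.a2 (A : AS f x t N) : 4 * N ≤ cn f (fun z => x z = 1) := by
  obtain ⟨W, p, hc, hD, g1, g2, gw, gc, gs, g3, hnc⟩ := A.sl
  by_contra hlt
  push Not at hlt
  apply hnc
  apply EC hD
  · rw [gw]
    exact fun h => A.hn (contained_of_two A.hx A.hs A.hm (Or.inl h))
  · rw [gw, hc]
    have e : 4 * (3 * N * 3 ^ (t + 1)) = (4 * N) * 3 ^ (t + 2) := by ring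
    rw [e]
    exact Nat.mul_lt_mul_of_pos_right hlt (by positivity)

lemma AS.a3 (A : AS f x t N) : cn f (fun z => x z = 1) = 4 * N ∧ cn f (fun z => x z = -1) = 4 * N := by
  have h1 := A.a2
  have h2 := A.neg.a2
  rw [cn_neg] at h2
  have sp := Wt_split f x
  have := A.hm
  have := A.hw
  omega

lemma AS.a4 (A : AS f x t N) : ∃ y, PI x y ∧ nn f x y 1 0 = 0 := by
  obtain ⟨W, p, hc, hD, g1, g2, gw, gc, gs, g3, hnc⟩ := A.sl
  exact lift_miss A.hx A.hs 1 f W p g2 g3 (E4 hD A.hN (by rw [gw, A.a3.1]) hc)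

lemma AS.two (A : AS f x t N) {y : V → F} (h : PI x y) (a b : F) (hab : a ≠ b)
    (ha : nn f x y (-1) a = 0) (hb : nn f x y (-1) b = 0) : False := by
  obtain ⟨c, hc⟩ : ∃ c : F, ∀ d, d ≠ c → d = a ∨ d = b := by
    refine ⟨-a - b, fun d hd => ?_⟩
    have h3 := three_zero (F := F)
    rcases tri (a - b) with h1 | h1 | h1
    · exact absurd (by linear_combination h1) hab
    · rcases tri (d - a) with h2 | h2 | h2
      · left; linear_combination h2
      · exact absurd (by linear_combination h2 - h1 + a * h3) hd
      · right; linear_combination h2 + h1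
    · rcases tri (d - a) with h2 | h2 | h2
      · left; linear_combination h2
      · right; linear_combination h2 + h1
      · exact absurd (by linear_combination h2 - h1 + a * h3) hd
  refine A.a1' (h.mod 0 (-c)) fun z hz hy => ?_
  rcases hc (y z) (fun h => hy (by simp [h])) with h | h
  · exact cn_zero.1 ha z ⟨hz, h⟩
  · exact cn_zero.1 hb z ⟨hz, h⟩

lemma nn_neg (f x y : V → F) (a b : F) : nn f (fun z => - x z) y a b = nn f x y (-a) b :=
  cn_congr fun z _ => by rw [neg_eq_iff_eq_neg]

lemma AS.a5 (A : AS f x t N) {y : V → F} (h : PI x y) (h0 : nn f x y 1 0 = 0) :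
    (nn f x y 1 1 = 2 * N ∧ nn f x y 1 (-1) = 2 * N) ∧ ∃ y', PI x y' ∧ (∀ z, x z = 1 → y' z = y z) ∧ cn f (fun z => y' z = 0) = 0 := by
  obtain ⟨W, p, hc, hD, g1, g2, gw, gc, gs, g3, hnc⟩ := A.sl
  have hP : ∀ b, nn f x y 1 b = 0 ∨ 2 * N ≤ nn f x y 1 b := by
    intro b
    have gc' := fun b => gc f (fun z => y z = b)
    have := hO1 (h.2.1.restr W p) (gs y h) hD 0 b (by rw [gc']; exact h0)
    rw [gc', hc] at this
    refine this.imp_right fun h => ?_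
    have e : nn f x y 1 b = cn f (fun z => x z = 1 ∧ y z = b) := rfl
    rw [e]
    have h2 : (2 * N) * (3 * 3 ^ (t + 1)) ≤ cn f (fun z => x z = 1 ∧ y z = b) * (3 * 3 ^ (t + 1)) := by linarith
    exact Nat.le_of_mul_le_mul_right h2 (by positivity)
  have p1 := (hP 1).resolve_left fun h1 => A.neg.two h.negl 0 1 zero_ne_one
    (by rw [nn_neg, neg_neg]; exact h0) (by rw [nn_neg, neg_neg]; exact h1)
  have p2 := (hP (-1)).resolve_left fun h1 => A.neg.two h.negl 0 (-1) (by simp)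
    (by rw [nn_neg, neg_neg]; exact h0) (by rw [nn_neg, neg_neg]; exact h1)
  have s1 := A.a3.1
  rw [nn_col f x y] at s1
  refine ⟨by omega, ?_⟩
  have hQ : ∀ b, nn f x y (-1) b = 0 ∨ 2 * N ≤ nn f x y (-1) b := by
    intro b
    have := mO A.hf A.hc (h.line 0 b).2.1 (h.line 0 b).swap.s1 0
    simp only [line_cn A.hm, add_zero] at this
    have e : cn f (fun z => x z = 1 ∧ y z = 0) = 0 := h0
    rwa [e, zero_add] at this
  obtain ⟨b, hb⟩ : ∃ b, nn f x y (-1) b = 0 := by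
    by_contra hcon
    push Not at hcon
    have := (hQ 0).resolve_left (hcon 0)
    have := (hQ 1).resolve_left (hcon 1)
    have := (hQ (-1)).resolve_left (hcon (-1))
    have s2 := A.a3.2
    rw [nn_col f x y] at s2
    have := A.hN
    omega
  refine ⟨_, h.line 0 b, ?_, ?_⟩
  · intro z hz; simp only [hz]; ring
  · rw [line_cn A.hm, add_zero, add_zero]
    unfold nn at h0 hb
    rw [h0, hb]

end
end RMx

namespace RMx
variable {F : Type} [Field F] [Fintype F] [hF : Fact (Fintype.card F = 3)]
variable {V : Type} [AddCommGroup V] [Module F V] [Finite V]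
section
variable {f : V → F} {t N : ℕ} {x : V → F}

lemma AS.t2 (A : AS f x (t + 1) N) : False := by
  obtain ⟨y, hy, h0⟩ := A.a4
  obtain ⟨⟨p1, p2⟩, -⟩ := A.a5 hy h0
  obtain ⟨W, p, hc, hD, g1, g2, gw, gc, gs, g3, hnc⟩ := A.sl
  apply hnc
  have gc' := fun b => gc f (fun z => y z = b)
  have ym : cn (fun w : W => f (p + w)) (fun w => y (p + w) = 0) = 0 := by rw [gc']; exact h0
  have yA := hy.2.1.restr W p
  have yS := gs y hy
  obtain ⟨U, q, hd, -, k2, kw, kc, ks, k3⟩ := slice yA yS 1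
  have hcU : Contained (fun u : U => f (p + ((q + u : W) : V))) := by
    apply OC (t := t)
    · exact hd.drop1 (f := fun w : W => f (p + w)) hD (surj_shift yS _) (-1) (fun z hz => cn_zero.1 ym z (by linear_combination hz))
    · rw [kw (fun w : W => f (p + w)), gc']
      have := A.hN
      unfold nn at p1
      omega
    · rw [kw (fun w : W => f (p + w)), gc']
      unfold nn at p1
      rw [p1]
      have := hd.card
      rw [hc] at this
      have e : 3 ^ (t + 1 + 1) = 3 ^ (t + 2) := rfl
      rw [e] at this
      linarith
  obtain ⟨z, hz, hzz⟩ := lift_cont yA yS 1 (fun w : W => f (p + w)) U q k2 k3 hcU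
  have e2 : cn (fun w : W => f (p + w)) (fun w => y (p + w) = -1) = 2 * N := by rw [gc']; exact p2
  have := A.hN
  refine twocol hz ym hzz N (2 * N) 1 ?_ ?_ (by omega) (by omega)
  · intro l hl hls c
    rw [one_mul]
    refine (hE (t := t + 2) hl hls hD c).imp_right fun h => ?_
    rw [hc] at h
    have h2 : N * (3 * 3 ^ (t + 2)) ≤ cn (fun w : W => f (p + w)) (fun z => l z = c) * (3 * 3 ^ (t + 2)) := by
      have e : 3 ^ (t + 1 + 1) = 3 ^ (t + 2) := rfl
      rw [e] at h
      linarith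
    exact Nat.le_of_mul_le_mul_right h2 (by positivity)
  · intro l hl hls a c ha
    rw [one_mul]
    refine (hO1 (t := t + 1) hl hls hD a c ha).imp_right fun h => ?_
    rw [hc] at h
    have h2 : (2 * N) * (3 * 3 ^ (t + 1 + 1)) ≤ cn (fun w : W => f (p + w)) (fun z => l z = c) * (3 * 3 ^ (t + 1 + 1)) := by
      linarith
    exact Nat.le_of_mul_le_mul_right h2 (by positivity)

lemma TS_of {x y z : V → F} (hx : Aff x) (hs : Function.Surjective x) (hy : Aff y) (hz : Aff z)
    (h : ∀ b c, ∃ s, x s = 1 ∧ y s = b ∧ z s = c) : TS x y z := by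
  refine ⟨hx, hy, hz, fun a b c => ?_⟩
  obtain ⟨l, l0, hl⟩ := hx
  obtain ⟨k, k0, hk⟩ := hy
  obtain ⟨n, n0, hn⟩ := hz
  obtain ⟨q, hq⟩ := hs 0
  obtain ⟨r, r1, r2, r3⟩ := h 0 0
  obtain ⟨s, s1, s2, s3⟩ := h (b - (1 - a) * y q) (c - (1 - a) * z q)
  refine ⟨s + (1 - a) • (q - r), ?_, ?_, ?_⟩
  · simp only [hl, map_add, map_smul, map_sub, smul_eq_mul] at *
    linear_combination s1 + (1 - a) * hq - (1 - a) * r1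
  · simp only [hk, map_add, map_smul, map_sub, smul_eq_mul] at *
    linear_combination s2 - (1 - a) * r2
  · simp only [hn, map_add, map_smul, map_sub, smul_eq_mul] at *
    linear_combination s3 - (1 - a) * r3

lemma AS.t1 (A : AS f x 0 N) : ∃ y z, TS x y z ∧ cn f (fun s => y s = 0) = 0 ∧ cn f (fun s => z s = 0) = 0 := by
  obtain ⟨y, hy, h0⟩ := A.a4
  obtain ⟨⟨p1, p2⟩, y', hy', hyy, ym'⟩ := A.a5 hy h0
  obtain ⟨W, p, hc, hD, g1, g2, gw, gc, gs, g3, hnc⟩ := A.sl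
  have gc' := fun b => gc f (fun z => y z = b)
  have ym : cn (fun w : W => f (p + w)) (fun w => y (p + w) = 0) = 0 := by rw [gc']; exact h0
  have yA := hy.2.1.restr W p
  have yS := gs y hy
  have hN := A.hN
  obtain ⟨U, q, hd, -, k2, kw, kc, ks, k3⟩ := slice yA yS 1
  have hcU : Missing (fun u : U => f (p + ((q + u : W) : V))) := by
    apply OM (t := 0)
    · exact hd.drop1 (f := fun w : W => f (p + w)) hD (surj_shift yS _) (-1) (fun z hz => cn_zero.1 ym z (by linear_combination hz))
    · rw [kw (fun w : W => f (p + w)), gc']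
      unfold nn at p1
      omega
    · rw [kw (fun w : W => f (p + w)), gc']
      unfold nn at p1
      rw [p1]
      have := hd.card
      rw [hc] at this
      norm_num at this ⊢
      linarith
  obtain ⟨z, hz, hz0⟩ := lift_miss yA yS 1 (fun w : W => f (p + w)) U q k2 k3 hcU
  have e2 : cn (fun w : W => f (p + w)) (fun w => y (p + w) = -1) = 2 * N := by rw [gc']; exact p2
  have hQ : ∀ b, nn (fun w : W => f (p + w)) (fun w => y (p + w)) z (-1) b = 0 ∨
      N ≤ nn (fun w : W => f (p + w)) (fun w => y (p + w)) z (-1) b := by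
    intro b
    have := hE (t := 1) (hz.line 0 b).2.1 (hz.line 0 b).swap.s1 hD 0
    rw [line_cn ym, add_zero, add_zero, hz0, zero_add] at this
    refine this.imp_right fun h => ?_
    unfold nn
    rw [hc] at h
    norm_num at h
    linarith
  obtain ⟨b, hb⟩ : ∃ b, nn (fun w : W => f (p + w)) (fun w => y (p + w)) z (-1) b = 0 := by
    by_contra hcon
    push Not at hcon
    have := (hQ 0).resolve_left (hcon 0)
    have := (hQ 1).resolve_left (hcon 1)
    have := (hQ (-1)).resolve_left (hcon (-1))
    rw [nn_col _ _ z] at e2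
    omega
  have hl := hz.line 0 b
  obtain ⟨z', hz', hzz'⟩ := g3 _ hl.2.1 hl.swap.s1
  have hm : nn f x z' 1 0 = 0 := by
    have := gc f (fun s => z' s = 0)
    unfold nn
    rw [← this]
    simp only [hzz']
    rw [line_cn ym, add_zero, add_zero]
    unfold nn at hb
    rw [hz0, hb]
  obtain ⟨-, z'', hz'', hzz, zm⟩ := A.a5 hz' hm
  refine ⟨y', z'', TS_of A.hx A.hs hy'.2.1 hz''.2.1 ?_, ym', zm⟩
  intro b c
  obtain ⟨w, h1, h2⟩ := hl.2.2 b c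
  refine ⟨p + w, g1 w, ?_, ?_⟩
  · rw [hyy _ (g1 w)]; exact h1
  · rw [hzz _ (g1 w), hzz']; exact h2

lemma AS.fin (A : AS f x t N) : t = 0 ∧ ∃ y z, TS x y z ∧ ∀ s, f s ≠ 0 ↔ x s ≠ 0 ∧ y s ≠ 0 ∧ z s ≠ 0 := by
  rcases t with _ | t
  swap
  · exact A.t2.elim
  refine ⟨rfl, ?_⟩
  obtain ⟨y, z, hT, hy, hz⟩ := A.t1
  refine ⟨y, z, hT, ?_⟩
  have sub : {s | f s ≠ 0} ⊆ {s | x s * y s * z s ≠ 0} := by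
    intro s hs
    refine mul_ne_zero (mul_ne_zero ?_ ?_) ?_
    · exact fun h => hs (cn_zero.1 A.hm s h)
    · exact fun h => hs (cn_zero.1 hy s h)
    · exact fun h => hs (cn_zero.1 hz s h)
  have le : Set.ncard {s | x s * y s * z s ≠ 0} ≤ Set.ncard {s | f s ≠ 0} := by
    change Wt (fun s => x s * y s * z s) ≤ Wt f
    rw [A.hw]
    set h : V → F := fun s => x s * y s * z s with hh
    have L := nnn_le hT h
    have hc := A.hc
    have x0 : cn h (fun s => x s = 0) = 0 := cn_zero.2 fun s hs => by simp [hh, hs]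
    have y0 : ∀ a, cn h (fun s => x s = a ∧ y s = 0) = 0 := fun a => cn_zero.2 fun s hs => by simp [hh, hs.2]
    have z0 : ∀ a b, cn h (fun s => (x s = a ∧ y s = b) ∧ z s = 0) = 0 := fun a b => cn_zero.2 fun s hs => by simp [hh, hs.2]
    have sz : ∀ a b, cn h (fun s => x s = a ∧ y s = b) ≤ 2 * N := by
      intro a b
      rw [cn_split h _ z, z0]
      have := L a b 1
      have := L a b (-1)
      omega
    have sy : ∀ a, cn h (fun s => x s = a) ≤ 4 * N := by
      intro a
      rw [cn_split h _ y, y0]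
      have := sz a 1
      have := sz a (-1)
      omega
    rw [Wt_split h x, x0]
    have := sy 1
    have := sy (-1)
    omega
  have := Set.eq_of_subset_of_ncard_le sub le (Set.toFinite _)
  intro s
  have h := Set.ext_iff.1 this s
  simpa [and_assoc] using h
end
end RMx

namespace RMx
variable {F : Type} [Field F] [Fintype F] [hF : Fact (Fintype.card F = 3)]
variable {V : Type} [AddCommGroup V] [Module F V] [Finite V]

lemma no8 {g : V → F} {N : ℕ} (hg : D 2 g) (hN : 0 < N) (hc : Nat.card V = 9 * N)
    (hw : Wt g = 8 * N) : False := by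
  obtain ⟨z0, hz0⟩ := ex_zero (f := g) (by omega)
  have key : ∀ c : F, c ≠ 0 → cn g (fun z => g z = c) ≤ 3 * N := by
    intro c hcn
    have h1 : D 2 (fun z => g z + -c) := D_add _ _ _ hg (D_const 1 (-c))
    have h2 : Wt (fun z => g z + -c) ≠ 0 := by
      intro h
      have := (Wt_zero.1 h) z0
      rw [hz0, zero_add, neg_eq_zero] at this
      exact hcn this
    have h3 := OB (t := 0) h2 h1
    have h4 := Set.ncard_add_ncard_compl {z | g z = c} (Set.toFinite _) (Set.toFinite _)
    have h5 : {z | g z = c}ᶜ = {z | g z + -c ≠ 0} := by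
      ext z; simp [add_neg_eq_zero]
    have h6 : cn g (fun z => g z = c) ≤ Set.ncard {z | g z = c} :=
      Set.ncard_le_ncard (fun z hz => hz.2) (Set.toFinite _)
    rw [h5] at h4
    unfold Wt at h3
    beta_reduce at h3
    omega
  have sp := Wt_split g g
  have h0 : cn g (fun z => g z = 0) = 0 := cn_zero.2 fun _ h => h
  have := key 1 one_ne_zero
  have := key (-1) (by simp)
  omega

def Conc {F : Type} [Field F] {V : Type} [AddCommGroup V] [Module F V] (f : V → F) (d : ℕ) : Prop :=
  ∃ (W : Submodule F V) (p : V) (x y z : V → F), Aff x ∧ Aff y ∧ Aff z ∧ Module.finrank F W = d ∧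
    (∀ a b c, ∃ w ∈ W, x (p + w) = a ∧ y (p + w) = b ∧ z (p + w) = c) ∧
    ∀ s, f s ≠ 0 ↔ s - p ∈ W ∧ x s ≠ 0 ∧ y s ≠ 0 ∧ z s ≠ 0

lemma mainT (k : ℕ) : ∀ (t : ℕ) (V : Type) [AddCommGroup V] [Module F V] [Finite V] (f : V → F),
    Module.finrank F V = t + 3 + k → D (2 * (t + 1) + 2) f → Wt f = 8 * 3 ^ k → Conc f (k + 3) := by
  intro t
  induction t with
  | zero =>
    intro V _ _ _ f hV hf hw
    have hc : Nat.card V = 9 * 3 ^ k * 3 ^ (0 + 1) := by rw [card_pow (F := F) V, hV]; ring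
    by_cases hC : Contained f
    · exfalso
      obtain ⟨x, hx, hs, hxz⟩ := hC
      obtain ⟨W, p, hd, he⟩ := hd_exists hx hs
      refine no8 (g := fun w : W => f (p + w)) (N := 3 ^ k) (hd.drop2 hf hs hxz) (by positivity) ?_ ?_
      · have := hd.card; rw [hc] at this; omega
      · rw [hd.wt, ← hw, Wt_eq]
        refine cn_congr fun z hz => ⟨fun _ => trivial, fun _ => ?_⟩
        by_contra h
        exact hz (hxz z h)
    · obtain ⟨x, hx, hs, hm⟩ := caseB hf (by positivity) hw hc
      obtain ⟨-, y, z, hT, h⟩ := AS.fin ⟨hf, by positivity, hw, hc, hx, hs, hm, hC⟩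
      refine ⟨⊤, 0, x, y, z, hT.1, hT.2.1, hT.2.2.1, ?_, ?_, ?_⟩
      · rw [finrank_top, hV]; omega
      · intro a b c
        obtain ⟨s, h⟩ := hT.2.2.2 a b c
        exact ⟨s, trivial, by simpa using h⟩
      · intro s; rw [h]; simp
  | succ t ih =>
    intro V _ _ _ f hV hf hw
    have hc : Nat.card V = 9 * 3 ^ k * 3 ^ (t + 1 + 1) := by rw [card_pow (F := F) V, hV]; ring
    by_cases hC : Contained f
    · obtain ⟨x, hx, hs, hxz⟩ := hC
      obtain ⟨W, p, hd, he⟩ := hd_exists hx hs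
      obtain ⟨W', p', x', y', z', hx', hy', hz', hr, hsu, hsp⟩ := ih W (fun w : W => f (p + w))
        (by have := hd.rank; omega) (hd.drop2 hf hs hxz) (by
        rw [hd.wt, ← hw, Wt_eq]
        refine cn_congr fun z hz => ⟨fun _ => trivial, fun _ => ?_⟩
        by_contra h
        exact hz (hxz z h))
      obtain ⟨x'', hx'', -, ex⟩ := he x' hx'
      obtain ⟨y'', hy'', -, ey⟩ := he y' hy'
      obtain ⟨z'', hz'', -, ez⟩ := he z' hz'
      refine ⟨W'.map W.subtype, p + p', x'', y'', z'', hx'', hy'', hz'', ?_, ?_, ?_⟩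
      · rw [Submodule.finrank_map_subtype_eq, hr]
      · intro a b c
        obtain ⟨w, hw, h1, h2, h3⟩ := hsu a b c
        refine ⟨w, ⟨w, hw, rfl⟩, ?_⟩
        have e : p + (p' : V) + (w : V) = p + ((p' + w : W) : V) := by push_cast; abel
        rw [e, ex, ey, ez]
        exact ⟨h1, h2, h3⟩
      · intro s
        constructor
        · intro h
          have hxs : x s = 0 := by by_contra h'; exact h (hxz s h')
          have hm := (hd.mem s).1 hxs
          have e : s = p + ((⟨s - p, hm⟩ : W) : V) := by simp
          obtain ⟨h0, h1⟩ := (hsp ⟨s - p, hm⟩).1 (by beta_reduce; rw [← e]; exact h)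
          refine ⟨⟨_, h0, ?_⟩, ?_⟩
          · simp [sub_sub]
          · rw [← ex, ← ey, ← ez, ← e] at h1
            exact h1
        · rintro ⟨⟨w, hw, h0⟩, h1⟩
          have e : s = p + ((p' + w : W) : V) := by
            rw [Submodule.subtype_apply] at h0
            push_cast
            rw [h0]; abel
          rw [e, ex, ey, ez] at h1
          rw [e]
          exact (hsp (p' + w)).2 ⟨by simpa using hw, h1⟩
    · obtain ⟨x, hx, hs, hm⟩ := caseB hf (by positivity) hw hc
      obtain ⟨h, -⟩ := AS.fin ⟨hf, by positivity, hw, hc, hx, hs, hm, hC⟩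
      omega

lemma hyp (W : Submodule F V) (p : V) {x : V → F} {l : V →ₗ[F] F} {c : F} (hl : ∀ z, x z = l z + c)
    (hs : ∀ a, ∃ w ∈ W, x (p + w) = a) (a : F) : ∃ H : AffineSubspace F V, H ≤ AffineSubspace.mk' p W ∧
      (H : Set V).Nonempty ∧ Module.finrank F H.direction + 1 = Module.finrank F W ∧
      H.direction = W ⊓ LinearMap.ker l ∧ ∀ s, s ∈ H ↔ s - p ∈ W ∧ x s = a := by
  obtain ⟨w, hw, hwa⟩ := hs a
  have hmem : ∀ s, s ∈ AffineSubspace.mk' (p + w) (W ⊓ LinearMap.ker l) ↔ s - p ∈ W ∧ x s = a := by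
    intro s
    rw [AffineSubspace.mem_mk', vsub_eq_sub, Submodule.mem_inf, LinearMap.mem_ker]
    have e : s - p = (s - (p + w)) + w := by abel
    refine and_congr ?_ ?_
    · rw [e, W.add_mem_iff_left hw]
    · rw [map_sub, sub_eq_zero, ← hwa, hl, hl, add_left_inj]
  refine ⟨AffineSubspace.mk' (p + w) (W ⊓ LinearMap.ker l), ?_, ?_, ?_, ?_, hmem⟩
  · intro s hs
    rw [AffineSubspace.mem_mk', vsub_eq_sub]
    exact ((hmem s).1 hs).1
  · exact ⟨p + w, (hmem _).2 ⟨by simpa using hw, hwa⟩⟩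
  · rw [AffineSubspace.direction_mk']
    have h1 := LinearMap.finrank_range_add_finrank_ker (l.domRestrict W)
    have h2 : LinearMap.range (l.domRestrict W) = ⊤ := by
      rw [LinearMap.range_eq_top]
      intro b
      obtain ⟨u, hu, hub⟩ := hs (a + b)
      refine ⟨⟨u - w, W.sub_mem hu hw⟩, ?_⟩
      rw [hl] at hub hwa
      simp only [map_add] at hub hwa
      simp only [LinearMap.domRestrict_apply, map_sub]
      linear_combination hub - hwa
    rw [h2, finrank_top, Module.finrank_self] at h1
    have h3 : W ⊓ LinearMap.ker l = (LinearMap.ker (l.domRestrict W)).map W.subtype := by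
      rw [LinearMap.ker_domRestrict, Submodule.map_comap_subtype]
    rw [h3, Submodule.finrank_map_subtype_eq]
    omega
  · rw [AffineSubspace.direction_mk']
end RMx

/-- For `q = 3`, `1 ≤ t ≤ m-2`, a second weight codeword of `R_3(2t+1, m)` (weight
`8·3^(m-t-2)`) has support contained in an affine subspace `A` of dimension `m-t+1`, equal
to the union of two parallel hyperplanes of `A` minus their intersection with two
non-parallel hyperplanes of `A`. -/
theorem stmt18 {F : Type} [Field F] [Fintype F] [DecidableEq F] {m t : ℕ}
    (hq : Fintype.card F = 3) (hm : 3 ≤ m) (ht1 : 1 ≤ t) (ht2 : t ≤ m - 2)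
    (f : (Fin m → F) → F)
    (hf : RM F (2 * t + 1) m f)
    (hw : wt f = 8 * 3 ^ (m - t - 2)) :
    ∃ A : AffineSubspace F (Fin m → F),
      (A : Set (Fin m → F)).Nonempty ∧ Module.finrank F A.direction = m - t + 1 ∧
      {x : Fin m → F | f x ≠ 0} ⊆ (A : Set (Fin m → F)) ∧
      ∃ H1 H2 W1 W2 : AffineSubspace F (Fin m → F),
        H1 ≤ A ∧ H2 ≤ A ∧ W1 ≤ A ∧ W2 ≤ A ∧
        (H1 : Set (Fin m → F)).Nonempty ∧ (H2 : Set (Fin m → F)).Nonempty ∧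
        (W1 : Set (Fin m → F)).Nonempty ∧ (W2 : Set (Fin m → F)).Nonempty ∧
        Module.finrank F H1.direction = m - t ∧
        Module.finrank F H2.direction = m - t ∧
        Module.finrank F W1.direction = m - t ∧
        Module.finrank F W2.direction = m - t ∧
        H1 ≠ H2 ∧ AffineSubspace.direction H1 = AffineSubspace.direction H2 ∧
        AffineSubspace.direction W1 ≠ AffineSubspace.direction W2 ∧
        {x : Fin m → F | f x ≠ 0} =
          ((H1 : Set (Fin m → F)) ∪ (H2 : Set (Fin m → F))) \
            ((W1 : Set (Fin m → F)) ∪ (W2 : Set (Fin m → F))) := by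
  haveI : Fact (Fintype.card F = 3) := ⟨hq⟩
  obtain ⟨P, hP, hPf⟩ := hf
  have hD : RMx.D (2 * t + 1 + 1) f := by
    have := RMx.D_poly P hP
    simpa only [hPf] using this
  have hW : RMx.Wt f = 8 * 3 ^ (m - t - 2) := by
    rw [← hw]
    unfold RMx.Wt wt
    rw [← Set.ncard_coe_finset]
    congr 1
    ext x; simp
  obtain ⟨t, rfl⟩ : ∃ s, t = s + 1 := ⟨t - 1, by omega⟩
  obtain ⟨W, p, x, y, z, ⟨l1, c1, hx⟩, ⟨l2, c2, hy⟩, ⟨l3, c3, hz⟩, hr, hs, hsp⟩ :=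
    RMx.mainT (m - (t + 1) - 2) t (Fin m → F) f (by rw [Module.finrank_fin_fun]; omega) hD hW
  have sx : ∀ a, ∃ w ∈ W, x (p + w) = a := fun a => by
    obtain ⟨w, hw, h, -⟩ := hs a 0 0; exact ⟨w, hw, h⟩
  have sy : ∀ a, ∃ w ∈ W, y (p + w) = a := fun a => by
    obtain ⟨w, hw, -, h, -⟩ := hs 0 a 0; exact ⟨w, hw, h⟩
  have sz : ∀ a, ∃ w ∈ W, z (p + w) = a := fun a => by
    obtain ⟨w, hw, -, -, h⟩ := hs 0 0 a; exact ⟨w, hw, h⟩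
  obtain ⟨H1, a1, a2, a3, a4, a5⟩ := RMx.hyp W p hx sx 1
  obtain ⟨H2, b1, b2, b3, b4, b5⟩ := RMx.hyp W p hx sx (-1)
  obtain ⟨W1, d1, d2, d3, d4, d5⟩ := RMx.hyp W p hy sy 0
  obtain ⟨W2, e1, e2, e3, e4, e5⟩ := RMx.hyp W p hz sz 0
  refine ⟨AffineSubspace.mk' p W, ⟨p, AffineSubspace.self_mem_mk' p W⟩, ?_, ?_, H1, H2, W1, W2, a1, b1, d1, e1,
    a2, b2, d2, e2, by omega, by omega, by omega, by omega, ?_, by rw [a4, b4], ?_, ?_⟩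
  · rw [AffineSubspace.direction_mk', hr]; omega
  · intro s hs
    rw [SetLike.mem_coe, AffineSubspace.mem_mk', vsub_eq_sub]
    exact ((hsp s).1 hs).1
  · rintro rfl
    obtain ⟨q, hq⟩ := a2
    have h1 := ((a5 q).1 hq).2
    have h2 := ((b5 q).1 hq).2
    exact RMx.two_ne (h1.symm.trans h2)
  · rw [d4, e4]
    intro h
    obtain ⟨u, hu, -, u2, u3⟩ := hs 0 0 0
    obtain ⟨v, hv, -, v2, v3⟩ := hs 0 0 1
    have h1 : v - u ∈ W ⊓ LinearMap.ker l2 := by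
      refine ⟨W.sub_mem hv hu, ?_⟩
      rw [hy, map_add] at u2 v2
      change l2 (v - u) = 0
      rw [map_sub]
      linear_combination v2 - u2
    rw [h] at h1
    have h2 : l3 (v - u) = 0 := h1.2
    rw [hz, map_add] at u3 v3
    rw [map_sub] at h2
    apply one_ne_zero (α := F)
    linear_combination h2 - v3 + u3
  · ext s
    simp only [Set.mem_setOf_eq, Set.mem_diff, Set.mem_union, SetLike.mem_coe, a5, b5, d5, e5]
    rw [hsp s]
    constructor
    · rintro ⟨h, h1, h2, h3⟩
      refine ⟨?_, ?_⟩
      · rcases RMx.tri (x s) with h' | h' | h'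
        · exact absurd h' h1
        · exact Or.inl ⟨h, h'⟩
        · exact Or.inr ⟨h, h'⟩
      · rintro (⟨-, h'⟩ | ⟨-, h'⟩)
        · exact h2 h'
        · exact h3 h'
    · rintro ⟨h | h, h'⟩
      · refine ⟨h.1, by rw [h.2]; exact one_ne_zero, fun hh => h' (Or.inl ⟨h.1, hh⟩), fun hh => h' (Or.inr ⟨h.1, hh⟩)⟩
      · refine ⟨h.1, by rw [h.2]; exact neg_ne_zero.2 one_ne_zero, fun hh => h' (Or.inl ⟨h.1, hh⟩), fun hh => h' (Or.inr ⟨h.1, hh⟩)⟩
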